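/- arXiv:2006.15558 — 2 statements merged into one kernel-verified Lean document; each statement's English description precedes it below -/
import Mathlib

section
/- Let d ≥ 2 and let T be the d-regular rooted tree with n levels. For a partial automorphism y of T chosen uniformly at random from the semigroup P_n of all partial automorphisms of T, let Ξ_n = (1/d^n) Σ_{k=1}^{d^n} δ_{λ_k} be the uniform probability measure on the eigenvalues λ_1, …, λ_{d^n} (listed with algebraic multiplicity) of the action matrix A_y. Then for every continuous function f on the closed unit disc D = {z ∈ ℂ : |z| ≤ 1}, the random variable ∫_D f dΞ_n converges in probability to f(0) as n → ∞; that is, Ξ_n converges weakly in probability to the delta-measure δ_0 concentrated at 0. -/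
/-- A partial injection of `X`, encoded as `X → Option X` injective on its domain. -/
def IsPInj {X : Type*} (f : X → Option X) : Prop :=
  ∀ ⦃x y z : X⦄, f x = some z → f y = some z → x = y

/-- The set of partial injections (partial bijections) of `X`;
for `X = Fin d` this is the symmetric inverse semigroup `I_d`. -/
abbrev PInj (X : Type*) := {f : X → Option X // IsPInj f}

instance {X : Type*} [Fintype X] [DecidableEq X] : DecidablePred (IsPInj (X := X)) :=
  fun _ => by unfold IsPInj; infer_instance

/-- Iterate of a partial map: `pIter g m` is the `m`-th power of `g` as a partial map,
with `dom (f ∘ g) = {x ∈ dom f : f x ∈ dom g}`. -/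
def pIter {α : Type*} (g : α → Option α) : ℕ → α → Option α
  | 0, x => some x
  | m + 1, x => (g x).bind (pIter g m)

/-- The `n`-th partial wreath power `P_n` of the symmetric inverse semigroup `I_d`:
`P_0` is trivial and `P_{n+1} = {(f, a) : a ∈ I_d, f : dom a → P_n}`. -/
def Pn (d : ℕ) : ℕ → Type
  | 0 => PUnit
  | n + 1 => Σ a : PInj (Fin d), ({x : Fin d // (a.1 x).isSome} → Pn d n)

instance PnFintype (d : ℕ) : ∀ n, Fintype (Pn d n)
  | 0 => inferInstanceAs (Fintype PUnit)
  | n + 1 =>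
      letI := PnFintype d n
      inferInstanceAs (Fintype (Σ a : PInj (Fin d), ({x : Fin d // (a.1 x).isSome} → Pn d n)))

/-- The action of `y ∈ P_n` on the `d^n` bottom-level vertices of the `d`-regular rooted
tree with `n` levels (encoded as paths `Fin n → Fin d`), as a partial injection. -/
def Pn.act {d : ℕ} : ∀ {n : ℕ}, Pn d n → (Fin n → Fin d) → Option (Fin n → Fin d)
  | 0, _, v => some v
  | _ + 1, y, v =>
    if h : (y.1.1 (v 0)).isSome then
      (Pn.act (y.2 ⟨v 0, h⟩) (Fin.tail v)).map
        (fun w => Fin.cons ((y.1.1 (v 0)).get h) w)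
    else none

/-- The action matrix `A_y` of `y ∈ P_n`: the `d^n × d^n` 0-1 matrix over `ℂ` whose
`(v, w)` entry is 1 iff `y` maps the bottom-level vertex `v` to `w`. -/
noncomputable def actMatrix {d n : ℕ} (y : Pn d n) : Matrix (Fin n → Fin d) (Fin n → Fin d) ℂ :=
  fun v w => if Pn.act y v = some w then 1 else 0

namespace SM
section
open Classical Function

/-- Total extension of a partial map to `Option`. -/
def lift {α : Type} (f : α → Option α) : Option α → Option α := fun o => o.bind f

/-- number of recurrent points -/
noncomputable def rcount {α : Type} [Fintype α] (f : α → Option α) : ℝ :=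
  ∑ x, if some x ∈ periodicPts (lift f) then (1 : ℝ) else 0

/-- number of cycles -/
noncomputable def cyc {α : Type} [Fintype α] (f : α → Option α) : ℝ :=
  ∑ x, ((minimalPeriod (lift f) (some x) : ℕ) : ℝ)⁻¹

/-- skew extension -/
def ext {X β : Type} (σ : X → Option X) (a : X → β → Option β) : X × β → Option (X × β) :=
  fun p => (σ p.1).bind fun x' => (a p.1 p.2).map fun j => (x', j)

lemma lift_iter_none {α : Type} (f : α → Option α) (k : ℕ) : (lift f)^[k] none = none := by
  induction k with
  | zero => rfl
  | succ k ih => rw [iterate_succ_apply]; exact ih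

lemma lift_iter_inj {α : Type} {f : α → Option α} (hf : IsPInj f) (k : ℕ) :
    ∀ {o₁ o₂ : Option α} {z : α}, (lift f)^[k] o₁ = some z → (lift f)^[k] o₂ = some z → o₁ = o₂ := by
  induction k with
  | zero => intro o₁ o₂ z h1 h2; simp at h1 h2; rw [h1, h2]
  | succ k ih =>
    intro o₁ o₂ z h1 h2
    rw [iterate_succ_apply'] at h1 h2
    simp only [lift, Option.bind_eq_some_iff] at h1 h2
    obtain ⟨u, hu, hu'⟩ := h1
    obtain ⟨v, hv, hv'⟩ := h2
    have := hf hu' hv'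
    subst this
    exact ih hu hv

lemma ext_pinj {X β : Type} {σ : X → Option X} {a : X → β → Option β} (hσ : IsPInj σ)
    (ha : ∀ x, IsPInj (a x)) : IsPInj (ext σ a) := by
  rintro ⟨x, i⟩ ⟨y, j⟩ ⟨z, k⟩ h1 h2
  simp only [ext, Option.bind_eq_some_iff, Option.map_eq_some_iff, Prod.mk.injEq] at h1 h2
  obtain ⟨x', hx, i', hi, rfl, rfl⟩ := h1
  obtain ⟨y', hy, j', hj, rfl, rfl⟩ := h2
  have := hσ hx hy
  subst this
  rw [ha _ hi hj]

lemma ext_fst {X β : Type} {σ : X → Option X} {a : X → β → Option β} (k : ℕ) :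
    ∀ {x x' : X} {i j : β}, (lift (ext σ a))^[k] (some (x, i)) = some (x', j) →
      (lift σ)^[k] (some x) = some x' := by
  induction k with
  | zero => intro x x' i j h; simp at h; simp [h.1]
  | succ k ih =>
    intro x x' i j h
    rw [iterate_succ_apply'] at h ⊢
    simp only [lift, ext, Option.bind_eq_some_iff, Option.map_eq_some_iff, Prod.mk.injEq] at h ⊢
    obtain ⟨⟨u, v⟩, h1, x'', h2, j', h3, rfl, rfl⟩ := h
    exact ⟨u, ih h1, h2⟩

lemma ext_congr {X β : Type} {σ : X → Option X} {a a' : X → β → Option β} (k : ℕ) :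
    ∀ {x : X} {i : β}, (∀ j < k, ∀ z, (lift σ)^[j] (some x) = some z → a z = a' z) →
      (lift (ext σ a))^[k] (some (x, i)) = (lift (ext σ a'))^[k] (some (x, i)) := by
  induction k with
  | zero => intros; rfl
  | succ k ih =>
    intro x i h
    rw [iterate_succ_apply, iterate_succ_apply]
    have h0 := h 0 (by omega) x rfl
    have e1 : lift (ext σ a) (some (x, i)) = lift (ext σ a') (some (x, i)) := by
      simp [lift, ext, h0]
    rw [e1]
    rcases h2 : lift (ext σ a') (some (x, i)) with _ | ⟨y, j⟩
    · rw [lift_iter_none, lift_iter_none]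
    · apply ih
      intro m hm z hz
      apply h (m+1) (by omega)
      have := ext_fst (σ := σ) (a := a') 1 h2
      rw [iterate_succ_apply]
      simp at this
      rw [this]; exact hz

/-- product expectation -/
noncomputable def E {X A : Type} [Fintype X] [Fintype A] (w : A → ℝ) (G : (X → A) → ℝ) : ℝ :=
  ∑ a : X → A, (∏ x, w (a x)) * G a

variable {X A : Type} [Fintype X] [Fintype A]

lemma E_mono {w : A → ℝ} (hw : ∀ a, 0 ≤ w a) {G H : (X → A) → ℝ} (h : ∀ a, G a ≤ H a) :
    E w G ≤ E w H :=
  Finset.sum_le_sum fun a _ => mul_le_mul_of_nonneg_left (h a) (Finset.prod_nonneg fun _ _ => hw _)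

lemma E_one {w : A → ℝ} (hw : ∑ a, w a = 1) : E w (fun _ : X → A => 1) = 1 := by
  unfold E
  simp only [mul_one]
  have := Finset.prod_univ_sum (fun _ : X => (Finset.univ : Finset A)) (fun _ a => w a)
  simp only [Fintype.piFinset_univ] at this
  rw [← this]; simp [hw]

lemma E_smul {w : A → ℝ} (c : ℝ) (G : (X → A) → ℝ) : E w (fun a => c * G a) = c * E w G := by
  unfold E; rw [Finset.mul_sum]; exact Finset.sum_congr rfl fun _ _ => by ring

lemma E_const {w : A → ℝ} (hw : ∑ a, w a = 1) (c : ℝ) : E w (fun _ : X → A => c) = c := by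
  have := E_smul (w := w) c (fun _ : X → A => 1)
  simpa [E_one hw] using this

lemma E_add {w : A → ℝ} (G H : (X → A) → ℝ) : E w (fun a => G a + H a) = E w G + E w H := by
  unfold E; rw [← Finset.sum_add_distrib]; exact Finset.sum_congr rfl fun _ _ => by ring

lemma E_sum {ι : Type} (s : Finset ι) {w : A → ℝ} (G : ι → (X → A) → ℝ) :
    E w (fun a => ∑ i ∈ s, G i a) = ∑ i ∈ s, E w (G i) := by
  unfold E; simp only [Finset.mul_sum]; rw [Finset.sum_comm]

lemma E_resample {w : A → ℝ} (hw : ∑ a, w a = 1) (x : X) (H : (X → A) → ℝ) :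
    E w H = E w (fun a => ∑ b, w b * H (update a x b)) := by
  unfold E
  have h1 : ∑ a : X → A, (∏ x, w (a x)) * H a =
      ∑ p : (X → A) × A, (∏ y, w (p.1 y)) * w p.2 * H p.1 := by
    rw [Fintype.sum_prod_type]
    refine Finset.sum_congr rfl fun a _ => ?_
    simp only []
    rw [← Finset.sum_mul, ← Finset.mul_sum, hw, mul_one]
  rw [h1]
  simp only [Finset.mul_sum]
  rw [← Fintype.sum_prod_type' (f := fun (a : X → A) (b : A) =>
    (∏ y, w (a y)) * (w b * H (update a x b)))]
  let e : (X → A) × A ≃ (X → A) × A :=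
    { toFun := fun p => (update p.1 x p.2, p.1 x)
      invFun := fun p => (update p.1 x p.2, p.1 x)
      left_inv := fun p => by simp
      right_inv := fun p => by simp }
  symm
  refine Fintype.sum_equiv e _ _ fun p => ?_
  obtain ⟨a, b⟩ := p
  simp only [e, Equiv.coe_fn_mk]
  have h2 : (∏ y, w (a y)) * w b = (∏ y, w (update a x b y)) * w (a x) := by
    rw [← Finset.mul_prod_erase _ _ (Finset.mem_univ x),
      ← Finset.mul_prod_erase _ (fun y => w (update a x b y)) (Finset.mem_univ x)]
    have : ∏ y ∈ Finset.univ.erase x, w (update a x b y) = ∏ y ∈ Finset.univ.erase x, w (a y) :=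
      Finset.prod_congr rfl fun y hy => by
        rw [update_of_ne (Finset.ne_of_mem_erase hy)]
    rw [this]; simp; ring
  rw [← h2]; ring

lemma E_push {B : Type} [Fintype B] {w : A → ℝ} {v : B → ℝ} (φ : A → B)
    (h : ∀ b, v b = ∑ a, if φ a = b then w a else 0) (G : (X → B) → ℝ) :
    E v G = E w (fun a => G (fun x => φ (a x))) := by
  unfold E
  have h1 : ∀ b : X → B, ∏ x, v (b x) =
      ∑ a : X → A, if (fun x => φ (a x)) = b then ∏ x, w (a x) else 0 := by
    intro b
    have := Finset.prod_univ_sum (fun _ : X => (Finset.univ : Finset A))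
      (fun x a => if φ a = b x then w a else 0)
    simp only [Fintype.piFinset_univ] at this
    simp only [h]
    rw [this]
    refine Finset.sum_congr rfl fun a _ => ?_
    split_ifs with hh
    · exact Finset.prod_congr rfl fun x _ => by rw [if_pos (congrFun hh x)]
    · obtain ⟨x, hx⟩ := Function.ne_iff.mp hh
      exact Finset.prod_eq_zero (Finset.mem_univ x) (if_neg hx)
  simp only [h1, Finset.sum_mul]
  rw [Finset.sum_comm]
  refine Finset.sum_congr rfl fun a _ => ?_
  simp [ite_mul]

/-- skew extension by partial bijections of `Fin d` -/
def sk {X : Type} {d : ℕ} (σ : X → Option X) (a : X → PInj (Fin d)) :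
    X × Fin d → Option (X × Fin d) := ext σ (fun x => (a x).1)

lemma sk_pinj {X : Type} {d : ℕ} {σ : X → Option X} (hσ : IsPInj σ) (a : X → PInj (Fin d)) :
    IsPInj (sk σ a) := ext_pinj hσ fun x => (a x).2

lemma sk_update {X : Type} {d : ℕ} {σ : X → Option X} {a : X → PInj (Fin d)} {x : X}
    {b : PInj (Fin d)} {k : ℕ} {x' : X} {i : Fin d}
    (h : ∀ j < k, (lift σ)^[j] (some x') ≠ some x) :
    (lift (sk σ (update a x b)))^[k] (some (x', i)) = (lift (sk σ a))^[k] (some (x', i)) := by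
  apply ext_congr
  intro j hj z hz
  have : z ≠ x := by rintro rfl; exact h j hj hz
  rw [update_of_ne this]

lemma sk_step {X : Type} {d : ℕ} {σ : X → Option X} {a : X → PInj (Fin d)} {x x' : X}
    (hx : σ x = some x') (i : Fin d) (k : ℕ) :
    (lift (sk σ a))^[k+1] (some (x, i)) =
      (lift (sk σ a))^[k] (((a x).1 i).map fun j => (x', j)) := by
  rw [iterate_succ_apply]; simp [lift, sk, ext, hx]

lemma sk_step_none {X : Type} {d : ℕ} {σ : X → Option X} {a : X → PInj (Fin d)} {x : X}
    (hx : σ x = none) (i : Fin d) (k : ℕ) :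
    (lift (sk σ a))^[k+1] (some (x, i)) = none := by
  rw [iterate_succ_apply]
  have : lift (sk σ a) (some (x, i)) = none := by simp [lift, sk, ext, hx]
  rw [this, lift_iter_none]

lemma return_prob {d : ℕ} {w : PInj (Fin d) → ℝ} (hw0 : ∀ a, 0 ≤ w a) (hw : ∑ a, w a = 1)
    {κ : ℝ} (hκ0 : 0 ≤ κ) (hκ : ∀ i j, ∑ b, w b * (if b.1 i = some j then 1 else 0) ≤ κ)
    {σ : X → Option X} (hσ : IsPInj σ) (k : ℕ) (x x₀ : X) (i j₀ : Fin d)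
    (hd : ∀ m, 0 < m → m < k + 1 → (lift σ)^[m] (some x) ≠ some x) :
    E w (fun a : X → PInj (Fin d) =>
      if (lift (sk σ a))^[k+1] (some (x, i)) = some (x₀, j₀) then (1 : ℝ) else 0) ≤ κ := by
  rcases hx : σ x with _ | x'
  · calc _ = E w (fun a : X → PInj (Fin d) => 0) := by
          congr 1; funext a; rw [sk_step_none hx]; simp
      _ = 0 := E_const hw 0
      _ ≤ κ := hκ0
  have hd' : ∀ m < k, (lift σ)^[m] (some x') ≠ some x := by
    intro m hm
    have := hd (m+1) (by omega) (by omega)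
    rw [iterate_succ_apply] at this
    simpa [lift, hx] using this
  rw [E_resample hw x]
  calc _ ≤ E w (fun a : X → PInj (Fin d) => κ) := ?_
    _ = κ := E_const hw κ
  apply E_mono hw0
  intro a
  have key : ∀ b : PInj (Fin d),
      (if (lift (sk σ (update a x b)))^[k+1] (some (x, i)) = some (x₀, j₀) then (1 : ℝ) else 0) =
      ∑ j, (if b.1 i = some j then 1 else 0) *
        (if (lift (sk σ a))^[k] (some (x', j)) = some (x₀, j₀) then (1 : ℝ) else 0) := by
    intro b
    rw [sk_step hx]
    simp only [update_self]
    rcases hb : b.1 i with _ | j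
    · simp [lift_iter_none]
    · simp only [Option.map_some, sk_update hd']
      simp only [Option.some.injEq, ite_mul, one_mul, zero_mul, Finset.sum_ite_eq,
        Finset.mem_univ, if_true]
  simp only [key, Finset.mul_sum]
  rw [Finset.sum_comm]
  calc _ = ∑ j, (∑ b, w b * (if b.1 i = some j then 1 else 0)) *
        (if (lift (sk σ a))^[k] (some (x', j)) = some (x₀, j₀) then (1 : ℝ) else 0) := by
        refine Finset.sum_congr rfl fun j _ => ?_
        rw [Finset.sum_mul]
        exact Finset.sum_congr rfl fun b _ => by ring
    _ ≤ ∑ j, κ *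
        (if (lift (sk σ a))^[k] (some (x', j)) = some (x₀, j₀) then (1 : ℝ) else 0) := by
        refine Finset.sum_le_sum fun j _ => ?_
        apply mul_le_mul_of_nonneg_right (hκ i j)
        split_ifs <;> norm_num
    _ = κ * ∑ j,
        (if (lift (sk σ a))^[k] (some (x', j)) = some (x₀, j₀) then (1 : ℝ) else 0) := by
        rw [Finset.mul_sum]
    _ ≤ κ * 1 := by
        apply mul_le_mul_of_nonneg_left _ hκ0
        rw [Finset.sum_boole]
        norm_cast
        rw [Finset.card_le_one]
        intro j hj j' hj'
        simp only [Finset.mem_filter, Finset.mem_univ, true_and] at hj hj'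
        have := lift_iter_inj (sk_pinj hσ a) k hj hj'
        simpa using this
    _ = κ := mul_one κ

lemma survive_prob {d : ℕ} {w : PInj (Fin d) → ℝ} (hw0 : ∀ a, 0 ≤ w a) (hw : ∑ a, w a = 1)
    {θ : ℝ} (hθ0 : 0 ≤ θ) (hθ : ∀ i, ∑ b, w b * (if b.1 i ≠ none then 1 else 0) ≤ θ)
    {σ : X → Option X} (k : ℕ) : ∀ (x : X) (i : Fin d)
    (_ : ∀ m n, m < n → n < k → (lift σ)^[m] (some x) ≠ (lift σ)^[n] (some x)),
    E w (fun a : X → PInj (Fin d) =>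
      if (lift (sk σ a))^[k] (some (x, i)) ≠ none then (1 : ℝ) else 0) ≤ θ ^ k := by
  induction k with
  | zero => intro x i _; simp [E_one hw]
  | succ k ih =>
    intro x i hd
    rcases hx : σ x with _ | x'
    · calc _ = E w (fun a : X → PInj (Fin d) => 0) := by
            congr 1; funext a; rw [sk_step_none hx]; simp
        _ = 0 := E_const hw 0
        _ ≤ _ := by positivity
    have hs : ∀ m, (lift σ)^[m+1] (some x) = (lift σ)^[m] (some x') := by
      intro m; rw [iterate_succ_apply]; simp [lift, hx]
    have hd' : ∀ m < k, (lift σ)^[m] (some x') ≠ some x := by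
      intro m hm
      have := hd 0 (m+1) (by omega) (by omega)
      rw [hs] at this
      exact fun h => this h.symm
    have ih' := fun j => ih x' j (by
      intro m n h1 h2
      have := hd (m+1) (n+1) (by omega) (by omega)
      rwa [hs, hs] at this)
    rw [E_resample hw x]
    have key : ∀ (a : X → PInj (Fin d)) (b : PInj (Fin d)),
        (if (lift (sk σ (update a x b)))^[k+1] (some (x, i)) ≠ none then (1 : ℝ) else 0) =
        ∑ j, (if b.1 i = some j then 1 else 0) *
          (if (lift (sk σ a))^[k] (some (x', j)) ≠ none then (1 : ℝ) else 0) := by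
      intro a b
      rw [sk_step hx]
      simp only [update_self]
      rcases hb : b.1 i with _ | j
      · simp [lift_iter_none]
      · simp only [Option.map_some, sk_update hd']
        simp only [Option.some.injEq, ite_mul, one_mul, zero_mul, Finset.sum_ite_eq,
          Finset.mem_univ, if_true]
    simp only [key]
    simp only [Finset.mul_sum]
    simp only [E_sum, E_smul]
    calc _ ≤ ∑ b, ∑ j, w b * ((if b.1 i = some j then 1 else 0) * θ ^ k) := by
          refine Finset.sum_le_sum fun b _ => Finset.sum_le_sum fun j _ => ?_
          apply mul_le_mul_of_nonneg_left _ (hw0 b)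
          apply mul_le_mul_of_nonneg_left (ih' j)
          split_ifs <;> norm_num
      _ = (∑ b, w b * (if b.1 i ≠ none then 1 else 0)) * θ ^ k := by
          rw [Finset.sum_mul]
          refine Finset.sum_congr rfl fun b _ => ?_
          rw [← Finset.mul_sum, ← Finset.sum_mul, mul_assoc]
          congr 2
          rcases b.1 i with _ | j <;> simp
      _ ≤ θ * θ ^ k := by
          apply mul_le_mul_of_nonneg_right (hθ i); positivity
      _ = θ ^ (k+1) := by ring

lemma period_of_sk {X : Type} {d : ℕ} {σ : X → Option X} {a : X → PInj (Fin d)} {x : X} {i : Fin d} {m : ℕ}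
    (h : IsPeriodicPt (lift (sk σ a)) m (some (x, i))) : IsPeriodicPt (lift σ) m (some x) :=
  ext_fst m h

lemma cyc_step {d : ℕ} (hd : 2 ≤ d) {w : PInj (Fin d) → ℝ} (hw0 : ∀ a, 0 ≤ w a)
    (hw : ∑ a, w a = 1)
    (hκ : ∀ i j, ∑ b, w b * (if b.1 i = some j then 1 else 0) ≤ (d : ℝ)⁻¹)
    {σ : X → Option X} (hσ : IsPInj σ) :
    E w (fun a : X → PInj (Fin d) => cyc (sk σ a)) ≤ (3 * d / 4 : ℝ) * cyc σ := by
  unfold cyc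
  rw [E_sum, Fintype.sum_prod_type, Finset.mul_sum]
  refine Finset.sum_le_sum fun x _ => ?_
  set l := minimalPeriod (lift σ) (some x) with hl
  have hdd : (2 : ℝ) ≤ d := by exact_mod_cast hd
  have hb : ∀ i : Fin d, E w (fun a : X → PInj (Fin d) =>
      ((minimalPeriod (lift (sk σ a)) (some (x, i)) : ℕ) : ℝ)⁻¹) ≤
      (l : ℝ)⁻¹ * (1/2 + 1/2 * (d : ℝ)⁻¹) := by
    intro i
    calc _ ≤ E w (fun a : X → PInj (Fin d) => (l : ℝ)⁻¹ * (1/2 + 1/2 *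
          (if (lift (sk σ a))^[l] (some (x, i)) = some (x, i) then (1 : ℝ) else 0))) := by
          apply E_mono hw0
          intro a
          set m := minimalPeriod (lift (sk σ a)) (some (x, i)) with hm
          have hper : IsPeriodicPt (lift (sk σ a)) m (some (x, i)) := isPeriodicPt_minimalPeriod _ _
          have hdvd : l ∣ m := (period_of_sk hper).minimalPeriod_dvd
          obtain ⟨q, hq⟩ := hdvd
          have hl0 : (0 : ℝ) ≤ (l : ℝ)⁻¹ := by positivity
          rcases q with _ | _ | q
          · have : (m : ℝ)⁻¹ = 0 := by simp [hq]
            rw [this]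
            split_ifs <;> positivity
          · have hml : m = l := by simpa using hq
            have : (lift (sk σ a))^[l] (some (x, i)) = some (x, i) := by
              rw [← hml]; exact hper
            rw [if_pos this, hml]; norm_num
          · have : (m : ℝ)⁻¹ ≤ (l : ℝ)⁻¹ * (1/2) := by
              rw [hq]; push_cast; rw [mul_inv]
              apply mul_le_mul_of_nonneg_left _ hl0
              rw [one_div]
              apply inv_anti₀ (by norm_num)
              have : (0 : ℝ) ≤ q := by positivity
              linarith
            refine this.trans (mul_le_mul_of_nonneg_left ?_ hl0)
            split_ifs <;> norm_num
      _ = (l : ℝ)⁻¹ * (1/2 + 1/2 * E w (fun a : X → PInj (Fin d) =>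
          (if (lift (sk σ a))^[l] (some (x, i)) = some (x, i) then (1 : ℝ) else 0))) := by
          rw [E_smul, E_add, E_const hw, E_smul]
      _ ≤ _ := by
          rcases Nat.eq_zero_or_pos l with h0 | hpos
          · simp [h0]
          obtain ⟨k, hk⟩ : ∃ k, l = k + 1 := ⟨l - 1, by omega⟩
          have := return_prob hw0 hw (κ := (d : ℝ)⁻¹) (by positivity) hκ hσ k x x i i (by
            intro m h1 h2 h3
            exact not_isPeriodicPt_of_pos_of_lt_minimalPeriod (f := lift σ) (x := some x)
              h1.ne' (by omega) h3)
          rw [← hk] at this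
          gcongr
  calc _ ≤ ∑ i : Fin d, (l : ℝ)⁻¹ * (1/2 + 1/2 * (d : ℝ)⁻¹) := Finset.sum_le_sum fun i _ => hb i
    _ = (l : ℝ)⁻¹ * (d/2 + 1/2) := by
        simp only [Finset.sum_const, Finset.card_univ, Fintype.card_fin, nsmul_eq_mul]
        field_simp
    _ ≤ (l : ℝ)⁻¹ * (3 * d / 4) := by
        gcongr; linarith
    _ = _ := by ring

lemma rcount_step {d : ℕ} {w : PInj (Fin d) → ℝ} (hw0 : ∀ a, 0 ≤ w a)
    (hw : ∑ a, w a = 1) {θ : ℝ} (hθ0 : 0 ≤ θ)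
    (hθ : ∀ i, ∑ b, w b * (if b.1 i ≠ none then 1 else 0) ≤ θ)
    {C : ℝ} (hC : ∀ l : ℕ, l * θ ^ l ≤ C) {σ : X → Option X} :
    E w (fun a : X → PInj (Fin d) => rcount (sk σ a)) ≤ (d * C : ℝ) * cyc σ := by
  unfold rcount cyc
  rw [E_sum, Fintype.sum_prod_type, Finset.mul_sum]
  refine Finset.sum_le_sum fun x _ => ?_
  set l := minimalPeriod (lift σ) (some x) with hl
  have hb : ∀ i : Fin d, E w (fun a : X → PInj (Fin d) =>
      if some (x, i) ∈ periodicPts (lift (sk σ a)) then (1 : ℝ) else 0) ≤ C * (l : ℝ)⁻¹ := by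
    intro i
    rcases Nat.eq_zero_or_pos l with h0 | hpos
    · have : ∀ a : X → PInj (Fin d), some (x, i) ∉ periodicPts (lift (sk σ a)) := by
        rintro a ⟨m, hm, hm'⟩
        have := minimalPeriod_pos_of_mem_periodicPts (f := lift σ) (x := some x)
          ⟨m, hm, period_of_sk hm'⟩
        omega
      simp [this, h0, E_const hw]
    · calc _ ≤ E w (fun a : X → PInj (Fin d) =>
            if (lift (sk σ a))^[l] (some (x, i)) ≠ none then (1 : ℝ) else 0) := by
            apply E_mono hw0
            intro a
            by_cases h1 : some (x, i) ∈ periodicPts (lift (sk σ a))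
            · have : (lift (sk σ a))^[l] (some (x, i)) ≠ none := by
                intro h
                obtain ⟨m, hm, hm'⟩ := h1
                have h2 : (lift (sk σ a))^[m * l] (some (x, i)) = some (x, i) :=
                  hm'.mul_const l
                obtain ⟨q, hq⟩ : ∃ q, m * l = q + l := ⟨m * l - l, by
                  have := Nat.le_mul_of_pos_left l hm; omega⟩
                rw [hq, iterate_add_apply, h, lift_iter_none] at h2
                simp at h2
              rw [if_pos h1, if_pos this]
            · rw [if_neg h1]; split_ifs <;> norm_num
        _ ≤ θ ^ l := by
            apply survive_prob hw0 hw hθ0 hθ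
            intro m n hmn hn h
            have := (iterate_eq_iterate_iff_of_lt_minimalPeriod (f := lift σ) (x := some x)
              (hmn.trans hn) hn).1 h
            omega
        _ ≤ C * (l : ℝ)⁻¹ := by
            have : (0 : ℝ) < l := by exact_mod_cast hpos
            rw [← div_eq_mul_inv, le_div_iff₀ this]
            linarith [hC l]
  calc _ ≤ ∑ i : Fin d, C * (l : ℝ)⁻¹ := Finset.sum_le_sum fun i _ => hb i
    _ = _ := by simp; ring

lemma E_prod {B : Type} [Fintype B] (w : A → ℝ) (v : B → ℝ) (G : (X → A × B) → ℝ) :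
    E (fun p : A × B => w p.1 * v p.2) G = E w (fun a => E v (fun b => G (fun x => (a x, b x)))) := by
  unfold E
  simp only [Finset.mul_sum]
  trans ∑ p : (X → A) × (X → B),
    (∏ x, w (p.1 x)) * ((∏ x, v (p.2 x)) * G (fun x => (p.1 x, p.2 x)))
  swap
  · rw [Fintype.sum_prod_type]
  let e : (X → A × B) ≃ (X → A) × (X → B) :=
    { toFun := fun p => (fun x => (p x).1, fun x => (p x).2)
      invFun := fun q x => (q.1 x, q.2 x)
      left_inv := fun _ => rfl
      right_inv := fun _ => rfl }
  refine Fintype.sum_equiv e _ _ fun p => ?_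
  simp only [e, Equiv.coe_fn_mk]
  simp [Finset.prod_mul_distrib, mul_assoc]

lemma E_curry {ι : Type} [Fintype ι] [DecidableEq ι] (v : A → ℝ) (G : (X → ι → A) → ℝ) :
    E (fun f : ι → A => ∏ i, v (f i)) G = E v (fun y : X × ι → A => G (fun x i => y (x, i))) := by
  unfold E
  symm
  refine @Fintype.sum_equiv (X × ι → A) (X → ι → A) ℝ (_) (_) _ (Equiv.curry X ι A) _ _ fun p => ?_
  rw [Fintype.prod_prod_type]
  rfl

lemma rcount_conj {α β : Type} [Fintype α] [Fintype β] (e : α ≃ β) {f : α → Option α}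
    {g : β → Option β} (h : ∀ x, g (e x) = (f x).map e) : rcount g = rcount f := by
  unfold rcount
  symm
  refine Fintype.sum_equiv e _ _ fun x => ?_
  have hs : Semiconj (Option.map e) (lift f) (lift g) := by
    intro o
    cases o with
    | none => rfl
    | some x => simp [lift, h]
  have hi : Injective (Option.map e) := Option.map_injective e.injective
  have : some x ∈ periodicPts (lift f) ↔ some (e x) ∈ periodicPts (lift g) := by
    constructor
    · rintro ⟨m, hm, h1⟩; exact ⟨m, hm, h1.map hs⟩
    · rintro ⟨m, hm, h1⟩
      refine ⟨m, hm, hi ?_⟩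
      rw [(hs.iterate_right m) (some x)]
      exact h1
  simp only [this]

instance pnNonempty (d : ℕ) : ∀ n, Nonempty (Pn d n)
  | 0 => ⟨PUnit.unit⟩
  | n + 1 => ⟨⟨⟨fun _ => none, fun x y z h => by simp at h⟩, fun x => absurd x.2 (by simp)⟩⟩

/-- cardinality of `P_n`, as a real -/
noncomputable def pc (d n : ℕ) : ℝ := Fintype.card (Pn d n)

lemma pc_pos (d n : ℕ) : 0 < pc d n := by
  unfold pc; exact_mod_cast Fintype.card_pos

/-- root weights -/
noncomputable def rw' (d n : ℕ) (a : PInj (Fin d)) : ℝ :=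
  pc d n ^ Fintype.card {x : Fin d // (a.1 x).isSome} / pc d (n+1)

lemma pc_succ (d n : ℕ) : pc d (n+1) =
    ∑ a : PInj (Fin d), pc d n ^ Fintype.card {x : Fin d // (a.1 x).isSome} := by
  have : Fintype.card (Pn d (n+1)) = Fintype.card
      (Σ a : PInj (Fin d), ({x : Fin d // (a.1 x).isSome} → Pn d n)) := by
    apply Fintype.card_congr; exact Equiv.refl _
  unfold pc
  rw [this, Fintype.card_sigma]
  push_cast
  refine Finset.sum_congr rfl fun a _ => ?_
  rw [Fintype.card_fun]; push_cast; rfl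

lemma rw_nonneg (d n : ℕ) (a : PInj (Fin d)) : 0 ≤ rw' d n a := by
  unfold rw'; have := pc_pos d n; have := pc_pos d (n+1); positivity

lemma rw_sum (d n : ℕ) : ∑ a, rw' d n a = 1 := by
  unfold rw'
  rw [← Finset.sum_div, ← pc_succ, div_self (pc_pos d (n+1)).ne']

/-- postcomposition by a permutation -/
def post {d : ℕ} (π : Equiv.Perm (Fin d)) : PInj (Fin d) ≃ PInj (Fin d) where
  toFun a := ⟨fun x => (a.1 x).map π, fun x y z h1 h2 => by
    simp only [Option.map_eq_some_iff] at h1 h2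
    obtain ⟨u, hu, rfl⟩ := h1
    obtain ⟨v, hv, hv'⟩ := h2
    rw [π.injective hv'] at hv
    exact a.2 hu hv⟩
  invFun a := ⟨fun x => (a.1 x).map π.symm, fun x y z h1 h2 => by
    simp only [Option.map_eq_some_iff] at h1 h2
    obtain ⟨u, hu, rfl⟩ := h1
    obtain ⟨v, hv, hv'⟩ := h2
    rw [π.symm.injective hv'] at hv
    exact a.2 hu hv⟩
  left_inv a := by ext x : 2; simp
  right_inv a := by ext x : 2; simp

lemma rw_post (d n : ℕ) (π : Equiv.Perm (Fin d)) (a : PInj (Fin d)) :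
    rw' d n (post π a) = rw' d n a := by
  unfold rw'
  congr 2
  apply Fintype.card_congr
  apply Equiv.subtypeEquivRight
  intro x; simp [post]

lemma rw_unif (d n : ℕ) (i j : Fin d) :
    ∑ b, rw' d n b * (if b.1 i = some j then 1 else 0) ≤ (d : ℝ)⁻¹ := by
  have hsymm : ∀ j', ∑ b, rw' d n b * (if b.1 i = some j' then 1 else 0) =
      ∑ b, rw' d n b * (if b.1 i = some j then (1 : ℝ) else 0) := by
    intro j'
    refine Fintype.sum_equiv (post (Equiv.swap j' j)) _ _ fun b => ?_
    rw [rw_post]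
    congr 1
    have : (post (Equiv.swap j' j) b).1 i = some j ↔ b.1 i = some j' := by
      simp only [post, Equiv.coe_fn_mk, Option.map_eq_some_iff]
      constructor
      · rintro ⟨u, hu, h⟩
        have : u = j' := by
          apply (Equiv.swap j' j).injective; rw [h]; simp
        rw [hu, this]
      · intro h; exact ⟨j', h, by simp⟩
    simp only [this]
  have hsum : ∑ j', ∑ b, rw' d n b * (if b.1 i = some j' then (1 : ℝ) else 0) ≤ 1 := by
    rw [Finset.sum_comm]
    refine le_of_le_of_eq (Finset.sum_le_sum fun b _ => ?_) (rw_sum d n)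
    rw [← Finset.mul_sum]
    calc _ ≤ rw' d n b * 1 := by
          apply mul_le_mul_of_nonneg_left _ (rw_nonneg d n b)
          rcases b.1 i with _ | u <;> simp
      _ = _ := mul_one _
  simp only [hsymm] at hsum
  have hd : (0 : ℝ) < d := by exact_mod_cast i.pos
  rw [Finset.sum_const, Finset.card_univ, Fintype.card_fin, nsmul_eq_mul] at hsum
  rw [← one_div, le_div_iff₀ hd, mul_comm]
  exact hsum

lemma rw_surv (d : ℕ) : ∃ θ : ℝ, 0 ≤ θ ∧ θ < 1 ∧
    ∀ i, ∑ b, rw' d 0 b * (if b.1 i ≠ none then 1 else 0) ≤ θ := by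
  let z : PInj (Fin d) := ⟨fun _ => none, fun x y z h => by simp at h⟩
  have hz : 0 < rw' d 0 z := by
    unfold rw'; have := pc_pos d 0; have := pc_pos d (0+1); positivity
  refine ⟨1 - rw' d 0 z, ?_, by linarith, ?_⟩
  · have := Finset.single_le_sum (f := rw' d 0) (fun b _ => rw_nonneg d 0 b) (Finset.mem_univ z)
    rw [rw_sum] at this; linarith
  · intro i
    have h2 : ∀ b, rw' d 0 b * (if b.1 i ≠ none then 1 else 0) ≤
        rw' d 0 b - (if b = z then rw' d 0 z else 0) := by
      intro b
      by_cases hb : b = z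
      · subst hb; simp [z]
      · rw [if_neg hb]
        have := rw_nonneg d 0 b
        split_ifs <;> simp [this]
    refine (Finset.sum_le_sum fun b _ => h2 b).trans ?_
    rw [Finset.sum_sub_distrib, rw_sum]; simp

/-- build an element of `P_{n+1}` -/
def mk {d n : ℕ} (a : PInj (Fin d)) (f : Fin d → Pn d n) : Pn d (n+1) := ⟨a, fun i => f i.1⟩

lemma fiber (d n : ℕ) (b : Pn d (n+1)) : (pc d (n+1))⁻¹ =
    ∑ p : PInj (Fin d) × (Fin d → Pn d n), if mk p.1 p.2 = b then
      rw' d n p.1 * ∏ _i : Fin d, (pc d n)⁻¹ else 0 := by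
  obtain ⟨a, g⟩ := b
  rw [Fintype.sum_prod_type]
  rw [Finset.sum_eq_single a]
  · have h1 : ∀ f : Fin d → Pn d n, (mk a f = (⟨a, g⟩ : Pn d (n+1))) ↔
        (fun i : {x : Fin d // (a.1 x).isSome} => f i.1) = g := by
      intro f
      unfold mk
      constructor
      · intro h; exact eq_of_heq (Sigma.mk.inj h).2
      · intro h; rw [h]
    simp only [h1]
    have h2 : ∑ f : Fin d → Pn d n,
        (if (fun i : {x : Fin d // (a.1 x).isSome} => f i.1) = g then
          rw' d n a * ∏ _i : Fin d, (pc d n)⁻¹ else 0) =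
        ∑ q : ({x : Fin d // (a.1 x).isSome} → Pn d n) × ({x : Fin d // ¬ (a.1 x).isSome} → Pn d n),
          if q.1 = g then rw' d n a * ∏ _i : Fin d, (pc d n)⁻¹ else 0 := by
      refine Fintype.sum_equiv
        (Equiv.piEquivPiSubtypeProd (fun x : Fin d => (a.1 x).isSome) (fun _ => Pn d n)) _ _ fun f => ?_
      rfl
    rw [h2, Fintype.sum_prod_type, Finset.sum_comm]
    simp only [Finset.sum_ite_eq', Finset.mem_univ, if_true, Finset.sum_const, Finset.card_univ,
      Fintype.card_fun, nsmul_eq_mul, Finset.prod_const, Fintype.card_fin]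
    push_cast
    have hc := Fintype.card_subtype_compl (fun x : Fin d => ((a.1 x).isSome : Prop))
    have hc2 := Fintype.card_subtype_le (fun x : Fin d => ((a.1 x).isSome : Prop))
    rw [Fintype.card_fin] at hc hc2
    unfold rw'
    set r := Fintype.card {x : Fin d // (a.1 x).isSome} with hr
    have hc3 : Fintype.card {x : Fin d // ¬ (a.1 x).isSome} = d - r := by
      convert hc
    rw [hc3]
    have := pc_pos d n
    have := pc_pos d (n+1)
    change _ = pc d n ^ (d - r) * _
    have h4 : pc d n ^ (d - r) * pc d n ^ r = pc d n ^ d := by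
      rw [← pow_add]; congr 1; omega
    rw [inv_pow]
    field_simp
    rw [← h4]
  · intro a' _ ha
    apply Finset.sum_eq_zero
    intro f _
    rw [if_neg]
    intro h
    exact ha (Sigma.mk.inj h).1
  · simp

lemma E_succ {d n : ℕ} (G : (X → Pn d (n+1)) → ℝ) :
    E (fun _ : Pn d (n+1) => (pc d (n+1))⁻¹) G =
    E (rw' d n) (fun a : X → PInj (Fin d) => E (fun _ : Pn d n => (pc d n)⁻¹)
      (fun y : X × Fin d → Pn d n => G (fun x => mk (a x) (fun i => y (x, i))))) := by
  rw [E_push (w := fun p : PInj (Fin d) × (Fin d → Pn d n) =>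
    rw' d n p.1 * ∏ _i : Fin d, (pc d n)⁻¹) (fun p => mk p.1 p.2) (fun b => fiber d n b) G]
  rw [E_prod (rw' d n) (fun f : Fin d → Pn d n => ∏ _i : Fin d, (pc d n)⁻¹)]
  congr 1
  funext a
  exact E_curry (fun _ : Pn d n => (pc d n)⁻¹) (fun f : X → Fin d → Pn d n => G (fun x => mk (a x) (f x)))

lemma rcount_zero {d : ℕ} (σ : X → Option X) (y : X → Pn d 0) :
    rcount (ext σ (fun x => Pn.act (y x))) = rcount σ := by
  refine rcount_conj (Equiv.prodUnique X (Fin 0 → Fin d)).symm fun x => ?_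
  simp only [ext, Pn.act]
  rcases h : σ x with _ | x'
  · simp [h]
  · simp [h]

lemma act_mk {d n : ℕ} (a : PInj (Fin d)) (f : Fin d → Pn d n) (i : Fin d) (v : Fin n → Fin d) :
    Pn.act (mk a f) (Fin.cons i v : Fin (n+1) → Fin d) =
      (a.1 i).bind fun j => (Pn.act (f i) v).map fun w => (Fin.cons j w : Fin (n+1) → Fin d) := by
  simp only [Pn.act, mk, Fin.cons_zero, Fin.tail_cons]
  split_ifs with hs
  · obtain ⟨j, hj⟩ := Option.isSome_iff_exists.1 hs
    simp [hj]
  · simp only [Bool.not_eq_true, Option.isSome_eq_false_iff, Option.isNone_iff_eq_none] at hs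
    simp [hs]

lemma rcount_succ {d n : ℕ} (σ : X → Option X) (a : X → PInj (Fin d)) (y : X × Fin d → Pn d n) :
    rcount (ext σ (fun x => Pn.act (mk (a x) (fun i => y (x, i))))) =
    rcount (ext (sk σ a) (fun x => Pn.act (y x))) := by
  let e : (X × Fin d) × (Fin n → Fin d) ≃ X × (Fin (n+1) → Fin d) :=
    (Equiv.prodAssoc X (Fin d) (Fin n → Fin d)).trans
      (Equiv.prodCongr (Equiv.refl X) (Fin.consEquiv (fun _ => Fin d)))
  refine rcount_conj e ?_
  rintro ⟨⟨x, i⟩, v⟩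
  have he : ∀ x i v, e ((x, i), v) = (x, Fin.cons i v) := fun _ _ _ => rfl
  rw [he]
  simp only [ext, sk]
  rcases h : σ x with _ | x'
  · simp
  · simp only [Option.bind_some]
    rw [act_mk]
    rcases h2 : (a x).1 i with _ | j
    · simp
    · rcases h3 : Pn.act (y (x, i)) v with _ | w
      · simp
      · simp [he]

lemma R_bound {d : ℕ} (hd : 2 ≤ d) : ∃ D : ℝ, ∀ (n : ℕ) (X : Type) [Fintype X]
    (σ : X → Option X), IsPInj σ →
    E (fun _ : Pn d (n+1) => (pc d (n+1))⁻¹)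
      (fun y : X → Pn d (n+1) => rcount (ext σ (fun x => Pn.act (y x)))) ≤
      D * (3 * d / 4 : ℝ) ^ n * cyc σ := by
  obtain ⟨θ, h0, h1, h2⟩ := rw_surv d
  obtain ⟨C, hC⟩ := (tendsto_self_mul_const_pow_of_lt_one h0 h1).bddAbove_range
  have hC' : ∀ l : ℕ, l * θ ^ l ≤ C := fun l => hC ⟨l, rfl⟩
  have hC0 : 0 ≤ C := by simpa using hC' 0
  refine ⟨d * C, fun n => ?_⟩
  induction n with
  | zero =>
    intro X _ σ hσ
    rw [E_succ]
    simp only [rcount_succ, rcount_zero]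
    have hu : ∑ _y : Pn d 0, (pc d 0)⁻¹ = 1 := by
      have := (pc_pos d 0).ne'
      simp only [Finset.sum_const, Finset.card_univ, nsmul_eq_mul]
      change pc d 0 * _ = 1
      field_simp
    simp only [E_const hu, pow_zero, mul_one]
    exact rcount_step (rw_nonneg d 0) (rw_sum d 0) h0 h2 hC'
  | succ n ih =>
    intro X _ σ hσ
    rw [E_succ]
    simp only [rcount_succ]
    calc _ ≤ E (rw' d (n+1)) (fun a : X → PInj (Fin d) =>
          (d * C) * (3 * d / 4 : ℝ) ^ n * cyc (sk σ a)) := by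
          apply E_mono (rw_nonneg d (n+1))
          intro a
          exact ih _ _ (sk_pinj hσ a)
      _ ≤ (d * C) * (3 * d / 4 : ℝ) ^ n * ((3 * d / 4 : ℝ) * cyc σ) := by
          rw [E_smul]
          apply mul_le_mul_of_nonneg_left _ (by positivity)
          exact cyc_step hd (rw_nonneg d _) (rw_sum d _) (rw_unif d _) hσ
      _ = _ := by ring

lemma act_pinj {d : ℕ} : ∀ {n : ℕ} (y : Pn d n), IsPInj (Pn.act y)
  | 0, _ => by
    intro v w z h1 h2
    exact Subsingleton.elim _ _
  | n + 1, y => by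
    obtain ⟨a, g⟩ := y
    intro v w z h1 h2
    simp only [Pn.act] at h1 h2
    split_ifs at h1 with hv
    split_ifs at h2 with hw
    simp only [Option.map_eq_some_iff] at h1 h2
    obtain ⟨u, hu, hu'⟩ := h1
    obtain ⟨t, ht, ht'⟩ := h2
    rw [← ht'] at hu'
    obtain ⟨h3, h4⟩ := Fin.cons_inj.1 hu'
    have h5 : v 0 = w 0 := a.2 (z := (a.1 (w 0)).get hw) (by rw [← h3]; simp) (by simp)
    subst h4
    have h6 : Fin.tail v = Fin.tail w := by
      have hg : g ⟨v 0, hv⟩ = g ⟨w 0, hw⟩ := by congr 1; exact Subtype.ext h5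
      rw [hg] at hu
      exact act_pinj _ hu ht
    rw [← Fin.cons_self_tail v, ← Fin.cons_self_tail w, h5, h6]

lemma dies {α : Type} [Finite α] {f : α → Option α} (hf : IsPInj f) {x : α}
    (hx : some x ∉ periodicPts (lift f)) : ∃ k, (lift f)^[k] (some x) = none := by
  by_contra! h
  obtain ⟨m, n, hmn, he⟩ := Finite.exists_ne_map_eq_of_infinite
    (fun k : ℕ => (lift f)^[k] (some x))
  wlog hlt : m < n generalizing m n
  · exact this n m hmn.symm he.symm (by omega)
  apply hx
  refine ⟨n - m, by omega, ?_⟩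
  obtain ⟨z, hz⟩ := Option.ne_none_iff_exists'.1 (h m)
  have he' : (lift f)^[m] ((lift f)^[n - m] (some x)) = some z := by
    rw [← iterate_add_apply, Nat.add_sub_cancel' hlt.le, ← he]; exact hz
  exact lift_iter_inj hf m he' hz

section linalg
variable {α : Type} [Fintype α] [DecidableEq α]

/-- matrix of a partial map -/
noncomputable def pmat (f : α → Option α) : Matrix α α ℂ := fun v w => if f v = some w then 1 else 0

lemma pmat_root_norm (f : α → Option α) {z : ℂ} (hz : z ∈ (pmat f).charpoly.roots) : ‖z‖ ≤ 1 := by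
  have h1 : (pmat f).charpoly.IsRoot z := Polynomial.isRoot_of_mem_roots hz
  rw [← Matrix.charpoly_toLin', ← Module.End.hasEigenvalue_iff_isRoot_charpoly] at h1
  obtain ⟨x, hx⟩ := h1.exists_hasEigenvector
  have hx0 := hx.2
  have hxe := hx.apply_eq_smul
  have hn : ‖(Matrix.toLin' (pmat f)) x‖ ≤ ‖x‖ := by
    rw [pi_norm_le_iff_of_nonneg (norm_nonneg _)]
    intro v
    rw [Matrix.toLin'_apply]
    simp only [Matrix.mulVec, dotProduct, pmat]
    rcases f v with _ | w
    · simp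
    · simpa using norm_le_pi_norm x w
  rw [hxe, norm_smul] at hn
  have : 0 < ‖x‖ := norm_pos_iff.2 hx0
  by_contra! hc
  nlinarith

/-- basis vector embedding -/
noncomputable def emb (o : Option α) : α → ℂ := o.elim 0 (fun w => Pi.single w 1)

lemma emb_step (f : α → Option α) (o : Option α) :
    Matrix.toLin' (pmat f).transpose (emb o) = emb (lift f o) := by
  rcases o with _ | v
  · simp [emb, lift]
  · simp only [emb, lift, Option.elim_some, Option.bind_some, Matrix.toLin'_apply,
      Matrix.mulVec_single_one]
    ext w
    simp only [Matrix.col_apply, Matrix.transpose_apply, pmat]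
    rcases f v with _ | u
    · simp
    · simp [Pi.single_apply, eq_comm]

lemma emb_iter (f : α → Option α) (k : ℕ) (o : Option α) :
    ((Matrix.toLin' (pmat f).transpose) ^ k) (emb o) = emb ((lift f)^[k] o) := by
  induction k generalizing o with
  | zero => simp
  | succ k ih => rw [pow_succ, Module.End.mul_apply, emb_step, ih, iterate_succ_apply]

lemma zero_mult {f : α → Option α} (hf : IsPInj f) :
    (Fintype.card α : ℝ) - rcount f ≤ ((pmat f).charpoly.rootMultiplicity 0 : ℕ) := by
  have h0 : (Fintype.card α : ℝ) - rcount f =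
      (Fintype.card {x : α // some x ∉ periodicPts (lift f)} : ℕ) := by
    unfold rcount
    rw [Finset.sum_boole, Fintype.card_subtype, sub_eq_iff_eq_add, ← Finset.card_univ]
    norm_cast
    rw [add_comm, Finset.card_filter_add_card_filter_not]
  rw [h0]
  norm_cast
  rw [← Matrix.charpoly_transpose, ← Matrix.charpoly_toLin', ← LinearMap.finrank_maxGenEigenspace_eq]
  have hli : LinearIndependent ℂ (fun x : {x : α // some x ∉ periodicPts (lift f)} =>
      (Pi.single x.1 1 : α → ℂ)) :=
    (Pi.linearIndependent_single_one α ℂ).comp _ Subtype.val_injective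
  rw [← finrank_span_eq_card hli]
  apply Submodule.finrank_mono
  rw [Submodule.span_le]
  rintro _ ⟨x, rfl⟩
  obtain ⟨k, hk⟩ := dies hf x.2
  simp only [SetLike.mem_coe, Module.End.mem_maxGenEigenspace, zero_smul, sub_zero]
  refine ⟨k, ?_⟩
  have := emb_iter f k (some x.1)
  rw [hk] at this
  exact this

lemma det_bound {f : α → Option α} (hf : IsPInj f) {F : ℂ → ℂ} {M : ℝ}
    (hM : ∀ z, ‖z‖ ≤ 1 → ‖F z‖ ≤ M) {N : ℂ} (hN : N = Fintype.card α) (hN0 : N ≠ 0) :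
    ‖(((pmat f).charpoly.roots.map F).sum) / N - F 0‖ ≤ 2 * M * rcount f / Fintype.card α := by
  set R := (pmat f).charpoly.roots with hR
  have hcard : R.card = Fintype.card α := by
    rw [hR, IsAlgClosed.card_roots_eq_natDegree, Matrix.charpoly_natDegree_eq_dim]
  have hM0 : 0 ≤ M := (norm_nonneg _).trans (hM 0 (by simp))
  have hsub : (R.map F).sum - N * F 0 = (R.map (fun z => F z - F 0)).sum := by
    rw [Multiset.sum_map_sub]
    simp [hcard, hN]
  have hc0 : R.card = R.count 0 + (R.filter (fun z => z ≠ 0)).card := by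
    have := congrArg Multiset.card (Multiset.filter_add_not (fun z => z = 0) R)
    rw [Multiset.card_add] at this
    rw [← this]
    congr 1
    rw [Multiset.count_eq_card_filter_eq]
    congr 1
    exact Multiset.filter_congr fun z _ => eq_comm
  have hfil : ((R.filter (fun z => z ≠ 0)).card : ℝ) ≤ rcount f := by
    have h1 := zero_mult hf
    rw [← Polynomial.count_roots, ← hR, ← hcard] at h1
    have h2 : (R.card : ℝ) = R.count 0 + (R.filter (fun z => z ≠ 0)).card := by exact_mod_cast hc0
    linarith
  have hsum : (R.map (fun z => F z - F 0)).sum =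
      ((R.filter (fun z => z ≠ 0)).map (fun z => F z - F 0)).sum := by
    conv_lhs => rw [← Multiset.filter_add_not (fun z => z ≠ 0) R]
    rw [Multiset.map_add, Multiset.sum_add]
    have : ((R.filter (fun z => ¬ z ≠ 0)).map (fun z => F z - F 0)).sum = 0 := by
      apply Multiset.sum_eq_zero
      intro u hu
      rw [Multiset.mem_map] at hu
      obtain ⟨z, hz, rfl⟩ := hu
      rw [Multiset.mem_filter] at hz
      rw [not_not.1 hz.2, sub_self]
    rw [this, add_zero]
  have hnorm : ‖(R.map (fun z => F z - F 0)).sum‖ ≤ 2 * M * rcount f := by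
    rw [hsum]
    refine (norm_multiset_sum_le _).trans ?_
    rw [Multiset.map_map]
    have := Multiset.sum_le_card_nsmul
      (((R.filter (fun z => z ≠ 0)).map ((fun z => ‖z‖) ∘ fun z => F z - F 0))) (2 * M) (by
        intro u hu
        rw [Multiset.mem_map] at hu
        obtain ⟨z, hz, rfl⟩ := hu
        have hz1 := pmat_root_norm f (Multiset.mem_filter.1 hz).1
        have := norm_sub_le (F z) (F 0)
        have h2 := hM z hz1
        have h3 := hM 0 (by simp)
        simp only [comp_apply]
        linarith)
    refine this.trans ?_
    rw [Multiset.card_map, nsmul_eq_mul, mul_comm]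
    gcongr
  have hN' : ‖N‖ = Fintype.card α := by rw [hN]; simp
  have : (R.map F).sum / N - F 0 = ((R.map F).sum - N * F 0) / N := by field_simp
  rw [this, norm_div, hN', hsub]
  gcongr

end linalg

lemma avg_bound {d : ℕ} (hd : 2 ≤ d) : ∃ K : ℝ, ∀ n : ℕ,
    (∑ y : Pn d (n+1), rcount (Pn.act y)) / pc d (n+1) ≤ K * (3 * d / 4 : ℝ) ^ n := by
  obtain ⟨D, hD⟩ := R_bound hd
  refine ⟨D * cyc (fun u : Unit => some u), fun n => ?_⟩
  have h := hD n Unit (fun u => some u) (by intro x y z _ _; rfl)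
  have h2 : E (fun _ : Pn d (n+1) => (pc d (n+1))⁻¹)
      (fun y : Unit → Pn d (n+1) => rcount (ext (fun u : Unit => some u) (fun x => Pn.act (y x)))) =
      (∑ y : Pn d (n+1), rcount (Pn.act y)) / pc d (n+1) := by
    unfold E
    rw [div_eq_inv_mul, Finset.mul_sum]
    refine @Fintype.sum_equiv _ _ ℝ (_) (_) _ (Equiv.funUnique Unit (Pn d (n+1))) _ _ fun y => ?_
    simp only [Finset.univ_unique, Finset.prod_singleton, Equiv.funUnique_apply]
    congr 1
    refine rcount_conj (Equiv.uniqueProd (Fin (n+1) → Fin d) Unit).symm fun v => ?_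
    simp [ext]
    rfl
  rw [h2] at h
  refine h.trans (le_of_eq (by ring))

lemma final (d : ℕ) (hd : 2 ≤ d) (f : ℂ → ℂ)
    (hf : ContinuousOn f {z : ℂ | ‖z‖ ≤ 1}) (ε : ℝ) (hε : 0 < ε) :
      Filter.Tendsto
        (fun n : ℕ =>
          (Nat.card {y : Pn d n //
              ε ≤ ‖(((pmat (Pn.act y)).charpoly.roots.map f).sum) / ((d : ℂ) ^ n) - f 0‖} : ℝ)
            / (Fintype.card (Pn d n) : ℝ))
        Filter.atTop (nhds 0) := by
  obtain ⟨K, hK⟩ := avg_bound hd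
  have hcomp : IsCompact {z : ℂ | ‖z‖ ≤ 1} := by
    have := isCompact_closedBall (0 : ℂ) 1
    convert this using 1
    ext z; simp
  obtain ⟨M, hM⟩ := hcomp.exists_bound_of_continuousOn hf
  have hM' : ∀ z, ‖z‖ ≤ 1 → ‖f z‖ ≤ M := fun z hz => hM z hz
  have hM0 : 0 ≤ M := (norm_nonneg _).trans (hM' 0 (by simp))
  have hd0 : (0 : ℝ) < d := by exact_mod_cast (by omega : 0 < d)
  have hdc : (d : ℂ) ≠ 0 := by exact_mod_cast (by omega : d ≠ 0)
  rw [← Filter.tendsto_add_atTop_iff_nat 1]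
  have hlim : Filter.Tendsto (fun n : ℕ => (2 * M * K / (ε * d)) * (3 / 4 : ℝ) ^ n)
      Filter.atTop (nhds 0) := by
    have := (tendsto_pow_atTop_nhds_zero_of_lt_one (r := (3 / 4 : ℝ)) (by norm_num)
      (by norm_num)).const_mul (2 * M * K / (ε * d))
    simpa using this
  refine squeeze_zero (fun n => by positivity) (fun n => ?_) hlim
  have hp := pc_pos d (n+1)
  change _ / pc d (n+1) ≤ _
  set P : Pn d (n+1) → Prop := fun y =>
    ε ≤ ‖(((pmat (Pn.act y)).charpoly.roots.map f).sum) / ((d : ℂ) ^ (n+1)) - f 0‖ with hP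
  have h1 : ε * (Nat.card {y // P y} : ℝ) ≤
      ∑ y : Pn d (n+1), 2 * M * rcount (Pn.act y) / (d : ℝ) ^ (n+1) := by
    rw [Nat.card_eq_fintype_card, Fintype.card_subtype, Finset.card_filter]
    push_cast
    rw [Finset.mul_sum]
    refine Finset.sum_le_sum fun y _ => ?_
    have hb := det_bound (act_pinj y) hM' (N := (d : ℂ) ^ (n+1)) (by simp) (by positivity)
    have hc : (Fintype.card (Fin (n+1) → Fin d) : ℝ) = (d : ℝ) ^ (n+1) := by simp
    rw [hc] at hb
    by_cases hy : P y
    · rw [if_pos hy, mul_one]; exact le_trans hy hb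
    · rw [if_neg hy, mul_zero]; exact le_trans (norm_nonneg _) hb
  have h2 : ∑ y : Pn d (n+1), 2 * M * rcount (Pn.act y) / (d : ℝ) ^ (n+1) =
      2 * M / (d : ℝ) ^ (n+1) * ∑ y : Pn d (n+1), rcount (Pn.act y) := by
    rw [Finset.mul_sum]; exact Finset.sum_congr rfl fun y _ => by ring
  have h3 := hK n
  rw [div_le_iff₀ hp] at h3 ⊢
  rw [h2] at h1
  have h4 : ε * (Nat.card {y // P y} : ℝ) ≤
      2 * M / (d : ℝ) ^ (n+1) * (K * (3 * d / 4 : ℝ) ^ n * pc d (n+1)) :=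
    h1.trans (mul_le_mul_of_nonneg_left h3 (by positivity))
  rw [mul_comm, ← le_div_iff₀ hε] at h4
  refine h4.trans (le_of_eq ?_)
  have : (3 * d / 4 : ℝ) ^ n = (3/4) ^ n * d ^ n := by rw [← mul_pow]; congr 1; ring
  rw [this]
  field_simp
  ring

end
end SM

/-- For `d ≥ 2`, the uniform distribution `Ξ_n` on the eigenvalues
(with algebraic multiplicity, i.e. the multiset of roots of the characteristic
polynomial over `ℂ`) of the action matrix `A_y` of a uniformly random `y ∈ P_n`
converges weakly in probability to the delta measure at `0`: for every continuous
function `f` on the closed unit disc, `∫ f dΞ_n → f 0` in probability as `n → ∞`. -/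
theorem spectral_measure_tendsto_delta_zero
    (d : ℕ) (hd : 2 ≤ d) (f : ℂ → ℂ)
    (hf : ContinuousOn f {z : ℂ | ‖z‖ ≤ 1}) :
    ∀ ε : ℝ, 0 < ε →
      Filter.Tendsto
        (fun n : ℕ =>
          (Nat.card {y : Pn d n //
              ε ≤ ‖(((actMatrix y).charpoly.roots.map f).sum) / ((d : ℂ) ^ n) - f 0‖} : ℝ)
            / (Fintype.card (Pn d n) : ℝ))
        Filter.atTop (nhds 0) := by
  intro ε hε
  exact SM.final d hd f hf ε hε
end

section
/- Let d ≥ 2. For y chosen uniformly at random from P_n, let ξ_n(y) be the fraction of non-zero eigenvalues (counted with algebraic multiplicity) of the d^n × d^n action matrix A_y, and η_n(y) = 1 − ξ_n(y) the fraction of zero eigenvalues. Then ξ_n(y) → 0 in probability as n → ∞ (equivalently, η_n(y) → 1 in probability). -/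
/-- `η_n(y)`: the multiplicity of `0` as a root of the characteristic polynomial of `A_y`,
i.e. the number of zero eigenvalues of `A_y` counted with algebraic multiplicity. -/
noncomputable def numZeroEig {d n : ℕ} (y : Pn d n) : ℕ :=
  ((actMatrix y).charpoly).rootMultiplicity 0

/-- Total map on `Option X` induced by a partial map of `X`. -/
def liftP {X : Type*} (g : X → Option X) : Option X → Option X := fun o => o.bind g

@[simp] theorem liftP_none {X : Type*} (g : X → Option X) : liftP g none = none := rfl
@[simp] theorem liftP_some {X : Type*} (g : X → Option X) (x : X) : liftP g (some x) = g x := rfl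

theorem liftP_iter_none {X : Type*} (g : X → Option X) (k : ℕ) : (liftP g)^[k] none = none := by
  induction k with
  | zero => rfl
  | succ k ih => rw [Function.iterate_succ_apply, liftP_none, ih]

noncomputable def perP {X : Type*} (g : X → Option X) (x : X) : ℕ :=
  Function.minimalPeriod (liftP g) (some x)

open Classical in
/-- Real-valued indicator of a proposition. -/
noncomputable def ind (p : Prop) : ℝ := if p then 1 else 0

theorem ind_pos {p : Prop} (h : p) : ind p = 1 := if_pos h
theorem ind_neg {p : Prop} (h : ¬ p) : ind p = 0 := if_neg h
theorem ind_nonneg (p : Prop) : 0 ≤ ind p := by unfold ind; split_ifs <;> norm_num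
theorem ind_le_one (p : Prop) : ind p ≤ 1 := by unfold ind; split_ifs <;> norm_num

noncomputable def numPer {X : Type*} [Fintype X] (g : X → Option X) : ℝ :=
  ∑ x, ind (0 < perP g x)

noncomputable def phiP {X : Type*} [Fintype X] (g : X → Option X) : ℝ :=
  ∑ x, 1 / (perP g x : ℝ)

theorem perP_conj {X Y : Type*} (e : X ≃ Y) (g : X → Option X) (g' : Y → Option Y)
    (h : ∀ x, g' (e x) = (g x).map e) (x : X) : perP g' (e x) = perP g x := by
  unfold perP
  rw [Function.minimalPeriod_eq_minimalPeriod_iff]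
  have key : ∀ n (o : Option X), (liftP g')^[n] (o.map e) = ((liftP g)^[n] o).map e := by
    intro n
    induction n with
    | zero => intro o; rfl
    | succ n ih =>
      intro o
      rw [Function.iterate_succ_apply, Function.iterate_succ_apply, ← ih]
      congr 1
      cases o with
      | none => rfl
      | some x => simp [h]
  intro n
  have := key n (some x)
  simp only [Option.map_some] at this
  unfold Function.IsPeriodicPt Function.IsFixedPt
  rw [this]
  constructor
  · intro h1
    exact Option.map_injective e.injective h1
  · intro h1
    rw [h1]; rfl

theorem numPer_conj {X Y : Type*} [Fintype X] [Fintype Y] (e : X ≃ Y) (g : X → Option X)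
    (g' : Y → Option Y) (h : ∀ x, g' (e x) = (g x).map e) : numPer g' = numPer g := by
  unfold numPer
  rw [← Equiv.sum_comp e]
  refine Finset.sum_congr rfl fun x _ => ?_
  rw [perP_conj e g g' h]

theorem periodic_of_image {X : Type*} [Fintype X] (g : X → Option X) (x w : X)
    (h : (liftP g)^[Fintype.card X] (some x) = some w) : 0 < perP g w := by
  set m := Fintype.card X with hm
  have hsome : ∀ i : Fin (m+1), ∃ z, (liftP g)^[i.1] (some x) = some z := by
    intro i
    rcases hz : (liftP g)^[i.1] (some x) with _ | z
    · exfalso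
      have : m = (m - i.1) + i.1 := by omega
      rw [this, Function.iterate_add_apply, hz, liftP_iter_none] at h
      cases h
    · exact ⟨z, rfl⟩
  choose z hz using hsome
  obtain ⟨i, j, hij, hzz⟩ := Fintype.exists_ne_map_eq_of_card_lt z (by simp [hm])
  wlog hlt : i.1 < j.1 generalizing i j
  · exact this j i hij.symm hzz.symm (by
      have : i.1 ≠ j.1 := fun h => hij (Fin.ext h)
      omega)
  have h1 : (liftP g)^[i.1] (some x) = (liftP g)^[j.1] (some x) := by rw [hz, hz, hzz]
  apply Function.IsPeriodicPt.minimalPeriod_pos (n := j.1 - i.1) (by omega)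
  unfold Function.IsPeriodicPt Function.IsFixedPt
  rw [← h, ← Function.iterate_add_apply]
  have e1 : j.1 - i.1 + m = (m - i.1) + j.1 := by omega
  have e2 : m = (m - i.1) + i.1 := by omega
  rw [e1]
  conv_rhs => rw [e2]
  rw [Function.iterate_add_apply, ← h1, ← Function.iterate_add_apply]

theorem matrix_pow_partial {X : Type*} [Fintype X] [DecidableEq X] (g : X → Option X)
    (A : Matrix X X ℂ) (hA : ∀ v w, A v w = if g v = some w then 1 else 0) (k : ℕ) :
    ∀ v w, (A ^ k) v w = if (liftP g)^[k] (some v) = some w then 1 else 0 := by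
  induction k with
  | zero => intro v w; simp [Matrix.one_apply]
  | succ k ih =>
    intro v w
    rw [pow_succ', Matrix.mul_apply, Function.iterate_succ_apply, liftP_some]
    simp only [hA, ih]
    rcases g v with _ | z
    · simp [liftP_iter_none]
    · rw [Finset.sum_eq_single z]
      · simp
      · intro b _ hb
        simp [hb.symm]
      · simp

theorem charpoly_bound {X : Type*} [Fintype X] [DecidableEq X] (g : X → Option X)
    (A : Matrix X X ℂ) (hA : ∀ v w, A v w = if g v = some w then 1 else 0) :
    ((Fintype.card X - A.charpoly.rootMultiplicity 0 : ℕ) : ℝ) ≤ numPer g := by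
  have h1 : (A ^ (Fintype.card X)).rank ≤ (Finset.univ.filter fun w => 0 < perP g w).card := by
    rw [← Matrix.rank_transpose]
    apply Matrix.rank_le_card_of_support_subset
    intro w hw
    simp only [Finset.coe_filter, Finset.mem_univ, true_and, Set.mem_ofPred_eq]
    by_contra hcon
    apply hw
    funext v
    have := matrix_pow_partial g A hA (Fintype.card X) v w
    rw [if_neg (fun h => hcon (periodic_of_image g v w h))] at this
    exact this
  have h2 : Module.finrank ℂ (LinearMap.ker (Matrix.toLin' A ^ Fintype.card X)) ≤
      A.charpoly.rootMultiplicity 0 := by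
    have := LinearMap.finrank_genEigenspace_le (Matrix.toLin' A) 0 (Fintype.card X)
    have hz : Matrix.toLin' A - (0:ℂ) • (1 : Module.End ℂ (X → ℂ)) = Matrix.toLin' A := by
      rw [zero_smul, sub_zero]
    rw [Matrix.charpoly_toLin', Module.End.genEigenspace_nat, hz] at this
    exact this
  have h3 := LinearMap.finrank_range_add_finrank_ker (Matrix.toLin' A ^ Fintype.card X)
  rw [← Matrix.toLin'_pow] at h3 h2
  have h4 : Module.finrank ℂ (LinearMap.range (Matrix.toLin' (A ^ Fintype.card X))) =
    (A ^ (Fintype.card X)).rank := by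
    rw [Matrix.rank, Matrix.toLin'_apply']
  rw [h4, Module.finrank_fintype_fun_eq_card] at h3
  have h5 : numPer g = ((Finset.univ.filter fun w => 0 < perP g w).card : ℝ) := by
    rw [Finset.card_filter]
    push_cast
    unfold numPer ind
    refine Finset.sum_congr rfl fun x _ => ?_
    split_ifs <;> rfl
  rw [h5]
  exact_mod_cast (by omega)

/-- Skew product of a partial map of `X` with a family of partial maps of `B`. -/
def skewP {X B : Type*} (g : X → Option X) (h : X → B → Option B) : X × B → Option (X × B) :=
  fun p => (g p.1).bind fun x' => (h p.1 p.2).map fun b => (x', b)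

theorem skewP_iter_fst {X B : Type*} (g : X → Option X) (h : X → B → Option B) (k : ℕ) :
    ∀ (o : Option (X × B)) q, (liftP (skewP g h))^[k] o = some q →
      (liftP g)^[k] (o.map Prod.fst) = some q.1 := by
  induction k with
  | zero => intro o q hq; simp at hq; simp [hq]
  | succ k ih =>
    intro o q hq
    rw [Function.iterate_succ_apply] at hq ⊢
    have := ih _ _ hq
    rw [← this]
    congr 1
    rcases o with _ | ⟨x, b⟩
    · rfl
    · rcases hs : skewP g h (x, b) with _ | r
      · rw [liftP_some, hs, liftP_iter_none] at hq; cases hq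
      · simp only [liftP_some, hs, Option.map_some]
        unfold skewP at hs
        rw [Option.bind_eq_some_iff] at hs
        obtain ⟨x', hx', hr⟩ := hs
        rw [Option.map_eq_some_iff] at hr
        obtain ⟨b', _, hb'⟩ := hr
        rw [← hb']; exact hx'

theorem skewP_iter_congr {X B : Type*} (g : X → Option X) (h h' : X → B → Option B) (x0 : X)
    (hh : ∀ x, x ≠ x0 → h x = h' x) (k : ℕ) :
    ∀ (o : Option (X × B)), (∀ m < k, (liftP g)^[m] (o.map Prod.fst) ≠ some x0) →
      (liftP (skewP g h))^[k] o = (liftP (skewP g h'))^[k] o := by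
  induction k with
  | zero => intro o _; rfl
  | succ k ih =>
    intro o ho
    rcases o with _ | ⟨x, b⟩
    · simp only [liftP_iter_none]
    · have hx : x ≠ x0 := by
        intro hx
        exact ho 0 (by omega) (by simp [hx])
      have e : skewP g h (x, b) = skewP g h' (x, b) := by
        unfold skewP; simp only [hh x hx]
      rw [Function.iterate_succ_apply, Function.iterate_succ_apply, liftP_some, liftP_some, e]
      rcases hs : skewP g h' (x, b) with _ | r
      · simp only [liftP_iter_none]
      · apply ih
        intro m hm
        have := ho (m+1) (by omega)
        rw [Function.iterate_succ_apply] at this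
        have h2 := skewP_iter_fst g h' 1 (some (x, b)) r hs
        simp only [Option.map_some, Function.iterate_one] at h2
        simpa [h2] using this

theorem indep_sum {X I : Type*} [Fintype X] [DecidableEq X] [Fintype I] (u : I → ℝ) (x0 : X)
    (φ : I → ℝ) (ψ : (X → I) → ℝ) (hψ : ∀ a c, ψ (Function.update a x0 c) = ψ a) :
    (∑ a : X → I, (∏ x, u (a x)) * (φ (a x0) * ψ a)) * (∑ c, u c) =
      (∑ c, u c * φ c) * ∑ a : X → I, (∏ x, u (a x)) * ψ a := by
  have inv : Function.Involutive (fun p : (X → I) × I => (Function.update p.1 x0 p.2, p.1 x0)) := by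
    rintro ⟨a, c⟩
    simp
  have hw : ∀ (a : X → I) c, (∏ x, u (Function.update a x0 c x)) * u (a x0)
      = (∏ x, u (a x)) * u c := by
    intro a c
    rw [← Finset.mul_prod_erase _ _ (Finset.mem_univ x0),
      ← Finset.mul_prod_erase Finset.univ (fun x => u (a x)) (Finset.mem_univ x0)]
    have : ∏ x ∈ Finset.univ.erase x0, u (Function.update a x0 c x) =
        ∏ x ∈ Finset.univ.erase x0, u (a x) := by
      refine Finset.prod_congr rfl fun x hx => ?_
      rw [Function.update_of_ne (Finset.ne_of_mem_erase hx)]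
    rw [this, Function.update_self]; ring
  rw [Finset.sum_mul_sum, mul_comm, Finset.sum_mul_sum, ← Fintype.sum_prod_type',
    ← Fintype.sum_prod_type']
  rw [← Equiv.sum_comp inv.toPerm]
  refine Finset.sum_congr rfl ?_
  rintro ⟨a, c⟩ _
  simp only [Function.Involutive.coe_toPerm, Function.update_self, hψ]
  linear_combination (φ c * ψ a) * hw a c

theorem one_step {X B I : Type*} [Fintype X] [DecidableEq X] [Fintype B] [Fintype I] (u : I → ℝ)
    (g : X → Option X) (h : I → B → Option B) (x x1 : X) (hx : g x = some x1) (k : ℕ)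
    (hne : ∀ m < k, (liftP g)^[m] (some x1) ≠ some x) (T : Option (X × B) → Prop)
    (hT : ¬ T none) (i : B) :
    (∑ a : X → I, (∏ z, u (a z)) *
      (ind (T ((liftP (skewP g fun z => h (a z)))^[k+1] (some (x, i))))))
        * (∑ c, u c) =
    ∑ j, (∑ c, u c * ind (h c i = some j)) *
      ∑ a : X → I, (∏ z, u (a z)) *
        (ind (T ((liftP (skewP g fun z => h (a z)))^[k] (some (x1, j))))) := by
  have key : ∀ a : X → I,
      (ind (T ((liftP (skewP g fun z => h (a z)))^[k+1] (some (x, i))))) =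
      ∑ j, (ind (h (a x) i = some j)) *
        (ind (T ((liftP (skewP g fun z => h (a z)))^[k] (some (x1, j))))) := by
    intro a
    rw [Function.iterate_succ_apply, liftP_some]
    have : skewP g (fun z => h (a z)) (x, i) = (h (a x) i).map fun b => (x1, b) := by
      simp [skewP, hx]
    rw [this]
    rcases h (a x) i with _ | j
    · simp [liftP_iter_none, hT, ind]
    · rw [Finset.sum_eq_single j]
      · simp [ind]
      · intro b _ hb
        simp [hb.symm, ind]
      · simp
  have key2 : ∑ a : X → I, (∏ z, u (a z)) *
      ind (T ((liftP (skewP g fun z => h (a z)))^[k+1] (some (x, i)))) =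
      ∑ j, ∑ a : X → I, (∏ z, u (a z)) * (ind (h (a x) i = some j) *
        ind (T ((liftP (skewP g fun z => h (a z)))^[k] (some (x1, j))))) := by
    rw [Finset.sum_comm]
    refine Finset.sum_congr rfl fun a _ => ?_
    rw [key, Finset.mul_sum]
  rw [key2, Finset.sum_mul]
  refine Finset.sum_congr rfl fun j _ => ?_
  have := indep_sum u x (fun c => ind (h c i = some j))
    (fun a => ind (T ((liftP (skewP g fun z => h (a z)))^[k] (some (x1, j))))) (by
      intro a c
      rw [skewP_iter_congr g (fun z => h (Function.update a x c z)) (fun z => h (a z)) x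
        (by intro z hz; simp only [Function.update_of_ne hz]) k (some (x1, j)) hne])
  exact this

theorem sum_prod_nonneg {X I : Type*} [Fintype X] (u : I → ℝ) (hu : ∀ c, 0 ≤ u c)
    (a : X → I) : 0 ≤ ∏ z, u (a z) := Finset.prod_nonneg fun _ _ => hu _

theorem surv_bound {X B I : Type*} [Fintype X] [DecidableEq X] [Fintype B] [Fintype I] (u : I → ℝ)
    (hu : ∀ c, 0 ≤ u c) (hU : 0 < ∑ c, u c) (g : X → Option X) (h : I → B → Option B) (r : ℝ)
    (hr0 : 0 ≤ r)
    (hr : ∀ i, ∑ c, u c * (ind (h c i ≠ none)) ≤ r * ∑ c, u c) (k : ℕ) :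
    ∀ x : X, (∀ m < k, ∀ m' < k, (liftP g)^[m] (some x) = (liftP g)^[m'] (some x) → m = m') →
    ∀ i : B, ∑ a : X → I, (∏ z, u (a z)) *
      (ind ((liftP (skewP g fun z => h (a z)))^[k] (some (x, i)) ≠ none))
        ≤ r ^ k * ∑ a : X → I, ∏ z, u (a z) := by
  induction k with
  | zero => intro x _ i; simp [ind]
  | succ k ih =>
    intro x hx i
    have hW : 0 ≤ ∑ a : X → I, ∏ z, u (a z) :=
      Finset.sum_nonneg fun a _ => sum_prod_nonneg u hu a
    rcases hg : g x with _ | x1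
    · have : ∀ a : X → I, (liftP (skewP g fun z => h (a z)))^[k+1] (some (x, i)) = none := by
        intro a
        rw [Function.iterate_succ_apply, liftP_some]
        simp [skewP, hg, liftP_iter_none]
      simp only [this, ind_neg (fun h : (none : Option (X × B)) ≠ none => h rfl), mul_zero,
        Finset.sum_const_zero]
      positivity
    · have h1 := one_step u g h x x1 hg k (by
        intro m hm he
        have := hx (m+1) (by omega) 0 (by omega) (by
          rw [Function.iterate_succ_apply, liftP_some, hg, he]; rfl)
        omega) (fun o => o ≠ none) (by simp) i
      have h2 : ∀ j, ∑ a : X → I, (∏ z, u (a z)) *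
        (ind ((liftP (skewP g fun z => h (a z)))^[k] (some (x1, j)) ≠ none))
          ≤ r ^ k * ∑ a : X → I, ∏ z, u (a z) := by
        apply ih
        intro m hm m' hm' he
        have := hx (m+1) (by omega) (m'+1) (by omega) (by
          rw [Function.iterate_succ_apply, Function.iterate_succ_apply, liftP_some, hg, he])
        omega
      have h3 : ∑ j, (∑ c, u c * ind (h c i = some j)) =
          ∑ c, u c * (ind (h c i ≠ none)) := by
        rw [Finset.sum_comm]
        refine Finset.sum_congr rfl fun c _ => ?_
        rw [← Finset.mul_sum]
        congr 1
        rcases h c i with _ | j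
        · simp [ind]
        · rw [Finset.sum_eq_single j]
          · simp [ind]
          · intro b _ hb
            simp [hb.symm, ind]
          · simp
      refine le_of_mul_le_mul_right ?_ hU
      rw [h1]
      calc _ ≤ ∑ j, (∑ c, u c * ind (h c i = some j)) *
              (r ^ k * ∑ a : X → I, ∏ z, u (a z)) := by
            refine Finset.sum_le_sum fun j _ => ?_
            refine mul_le_mul_of_nonneg_left (h2 j) ?_
            refine Finset.sum_nonneg fun c _ => mul_nonneg (hu c) ?_
            exact ind_nonneg _
        _ = (∑ c, u c * (ind (h c i ≠ none))) *
              (r ^ k * ∑ a : X → I, ∏ z, u (a z)) := by rw [← Finset.sum_mul, h3]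
        _ ≤ (r * ∑ c, u c) * (r ^ k * ∑ a : X → I, ∏ z, u (a z)) :=
            mul_le_mul_of_nonneg_right (hr i) (by positivity)
        _ = _ := by ring

theorem fix_bound {X B I : Type*} [Fintype X] [DecidableEq X] [Fintype B] [Fintype I] (u : I → ℝ)
    (hu : ∀ c, 0 ≤ u c) (hU : 0 < ∑ c, u c) (g : X → Option X) (h : I → B → Option B)
    (hp : ∀ i j, (Fintype.card B : ℝ) * ∑ c, u c * (ind (h c i = some j))
      ≤ ∑ c, u c) (hB : 0 < Fintype.card B) (x : X) (hx : 0 < perP g x) :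
    ∑ a : X → I, (∏ z, u (a z)) *
      ∑ i, (ind ((liftP (skewP g fun z => h (a z)))^[perP g x] (some (x, i)) = some (x, i)))
        ≤ ∑ a : X → I, ∏ z, u (a z) := by
  have hper : (liftP g)^[perP g x] (some x) = some x :=
    Function.iterate_minimalPeriod
  have hmin : ∀ m, 0 < m → m < perP g x → (liftP g)^[m] (some x) ≠ some x := by
    intro m hm0 hm he
    exact Function.not_isPeriodicPt_of_pos_of_lt_minimalPeriod hm0.ne' hm he
  obtain ⟨k, hk⟩ : ∃ k, perP g x = k + 1 := ⟨perP g x - 1, by omega⟩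
  rw [hk] at hper hmin ⊢
  rcases hg : g x with _ | x1
  · rw [Function.iterate_succ_apply, liftP_some, hg, liftP_iter_none] at hper
    cases hper
  have hB' : (0:ℝ) < Fintype.card B := by exact_mod_cast hB
  have h1 := fun i => one_step u g h x x1 hg k (by
        intro m hm he
        refine hmin (m+1) (by omega) (by omega) ?_
        rw [Function.iterate_succ_apply, liftP_some, hg, he]) (fun o => o = some (x, i))
          (by simp) i
  refine le_of_mul_le_mul_right ?_ hU
  refine le_of_mul_le_mul_left ?_ hB'
  have hsw : ∑ a : X → I, (∏ z, u (a z)) *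
      ∑ i, ind ((liftP (skewP g fun z => h (a z)))^[k + 1] (some (x, i)) = some (x, i)) =
      ∑ i, ∑ a : X → I, (∏ z, u (a z)) *
        ind ((liftP (skewP g fun z => h (a z)))^[k + 1] (some (x, i)) = some (x, i)) := by
    rw [Finset.sum_comm]
    refine Finset.sum_congr rfl fun a _ => ?_
    rw [Finset.mul_sum]
  rw [hsw, Finset.sum_mul, Finset.sum_congr rfl fun i _ => h1 i, Finset.mul_sum]
  calc _ ≤ ∑ i, ∑ j, (∑ c, u c) * ∑ a : X → I, (∏ z, u (a z)) *
        (ind ((liftP (skewP g fun z => h (a z)))^[k] (some (x1, j)) = some (x, i))) := by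
        refine Finset.sum_le_sum fun i _ => ?_
        rw [Finset.mul_sum]
        refine Finset.sum_le_sum fun j _ => ?_
        rw [← mul_assoc]
        refine mul_le_mul_of_nonneg_right (hp i j) ?_
        refine Finset.sum_nonneg fun a _ => mul_nonneg (sum_prod_nonneg u hu a) ?_
        exact ind_nonneg _
    _ = ∑ j : B, (∑ c, u c) * ∑ a : X → I, (∏ z, u (a z)) *
        ∑ i, (ind ((liftP (skewP g fun z => h (a z)))^[k] (some (x1, j)) = some (x, i))) := by
        rw [Finset.sum_comm]
        refine Finset.sum_congr rfl fun j _ => ?_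
        rw [← Finset.mul_sum, Finset.sum_comm]
        simp_rw [Finset.mul_sum]
    _ ≤ ∑ j : B, (∑ c, u c) * ∑ a : X → I, (∏ z, u (a z)) * 1 := by
        refine Finset.sum_le_sum fun j _ => mul_le_mul_of_nonneg_left ?_ hU.le
        refine Finset.sum_le_sum fun a _ =>
          mul_le_mul_of_nonneg_left ?_ (sum_prod_nonneg u hu a)
        rcases (liftP (skewP g fun z => h (a z)))^[k] (some (x1, j)) with _ | ⟨y, i0⟩
        · simp [ind]
        · rw [Finset.sum_eq_single i0]
          · exact ind_le_one _
          · intro b _ hb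
            simp [hb.symm, ind]
          · simp
    _ = _ := by
      simp only [Finset.sum_const, Finset.card_univ, nsmul_eq_mul, mul_one]
      ring

theorem perP_skew_dvd {X B : Type*} (g : X → Option X) (h : X → B → Option B) (x : X) (i : B)
    (hp : 0 < perP (skewP g h) (x, i)) :
    0 < perP g x ∧ perP g x ∣ perP (skewP g h) (x, i) := by
  have h1 : (liftP (skewP g h))^[perP (skewP g h) (x, i)] (some (x, i)) = some (x, i) :=
    Function.iterate_minimalPeriod
  have h2 := skewP_iter_fst _ _ _ _ _ h1
  simp only [Option.map_some] at h2
  exact ⟨Function.IsPeriodicPt.minimalPeriod_pos hp h2, Function.IsPeriodicPt.minimalPeriod_dvd h2⟩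

theorem inv_per_le {X B : Type*} (g : X → Option X) (h : X → B → Option B) (x : X) (i : B) :
    1 / (perP (skewP g h) (x, i) : ℝ) ≤ (1 / (perP g x : ℝ)) *
      ((1 + ind ((liftP (skewP g h))^[perP g x] (some (x, i)) = some (x, i))) / 2) := by
  rcases Nat.eq_zero_or_pos (perP (skewP g h) (x, i)) with h0 | hpos
  · rw [h0]
    simp only [Nat.cast_zero, div_zero]
    refine mul_nonneg (by positivity) ?_
    linarith [ind_nonneg ((liftP (skewP g h))^[perP g x] (some (x, i)) = some (x, i))]
  · obtain ⟨hL, c, hc⟩ := perP_skew_dvd g h x i hpos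
    have h1 : (liftP (skewP g h))^[perP (skewP g h) (x, i)] (some (x, i)) = some (x, i) :=
      Function.iterate_minimalPeriod
    have hc0 : c ≠ 0 := by rintro rfl; omega
    have hL' : (0:ℝ) < perP g x := by exact_mod_cast hL
    rcases Nat.lt_or_ge 1 c with hc1 | hc1
    · have : (2:ℝ) ≤ c := by exact_mod_cast hc1
      calc 1 / (perP (skewP g h) (x, i) : ℝ) = (1 / (perP g x : ℝ)) * (1 / c) := by
            rw [hc]; push_cast; field_simp
        _ ≤ (1 / (perP g x : ℝ)) * (1 / 2) := by gcongr
        _ ≤ _ := by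
          gcongr
          linarith [ind_nonneg ((liftP (skewP g h))^[perP g x] (some (x, i)) = some (x, i))]
    · have : c = 1 := by omega
      rw [this, mul_one] at hc
      rw [← hc, ind_pos h1]
      norm_num

theorem phi_step {X B I : Type*} [Fintype X] [DecidableEq X] [Fintype B] [Fintype I] (u : I → ℝ)
    (hu : ∀ c, 0 ≤ u c) (hU : 0 < ∑ c, u c) (g : X → Option X) (h : I → B → Option B)
    (hp : ∀ i j, (Fintype.card B : ℝ) * ∑ c, u c * ind (h c i = some j)
      ≤ ∑ c, u c) (hB : 0 < Fintype.card B) :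
    ∑ a : X → I, (∏ z, u (a z)) * phiP (skewP g fun z => h (a z)) ≤
      (((Fintype.card B : ℝ) + 1) / 2) * (∑ a : X → I, ∏ z, u (a z)) * phiP g := by
  have hW : 0 ≤ ∑ a : X → I, ∏ z, u (a z) :=
      Finset.sum_nonneg fun a _ => sum_prod_nonneg u hu a
  have main : ∀ x, ∑ a : X → I, (∏ z, u (a z)) *
      ∑ i, 1 / (perP (skewP g fun z => h (a z)) (x, i) : ℝ) ≤
      (((Fintype.card B : ℝ) + 1) / 2) * (∑ a : X → I, ∏ z, u (a z)) * (1 / (perP g x : ℝ)) := by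
    intro x
    rcases Nat.eq_zero_or_pos (perP g x) with h0 | hpos
    · have : ∀ (a : X → I) i, perP (skewP g fun z => h (a z)) (x, i) = 0 := by
        intro a i
        by_contra hcon
        have := (perP_skew_dvd g _ x i (Nat.pos_of_ne_zero hcon)).1
        omega
      simp [this, h0, ind]
    · have hf := fix_bound u hu hU g h hp hB x hpos
      calc _ ≤ ∑ a : X → I, (∏ z, u (a z)) * ∑ i, (1 / (perP g x : ℝ)) *
            ((1 + ind ((liftP (skewP g fun z => h (a z)))^[perP g x] (some (x, i)) = some (x, i))) / 2) := by
            refine Finset.sum_le_sum fun a _ =>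
              mul_le_mul_of_nonneg_left ?_ (sum_prod_nonneg u hu a)
            exact Finset.sum_le_sum fun i _ => inv_per_le _ _ _ _
        _ = (1 / (perP g x : ℝ)) / 2 * (Fintype.card B * (∑ a : X → I, ∏ z, u (a z)) +
            ∑ a : X → I, (∏ z, u (a z)) *
              ∑ i, (ind ((liftP (skewP g fun z => h (a z)))^[perP g x] (some (x, i)) = some (x, i)))) := by
            rw [Finset.mul_sum, ← Finset.sum_add_distrib, Finset.mul_sum]
            refine Finset.sum_congr rfl fun a _ => ?_
            rw [← Finset.mul_sum, ← Finset.sum_div, Finset.sum_add_distrib]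
            simp only [Finset.sum_const, Finset.card_univ, nsmul_eq_mul, mul_one]
            ring
        _ ≤ (1 / (perP g x : ℝ)) / 2 * (Fintype.card B * (∑ a : X → I, ∏ z, u (a z)) +
              ∑ a : X → I, ∏ z, u (a z)) := by gcongr
        _ = _ := by ring
  have hsw : ∑ a : X → I, (∏ z, u (a z)) * phiP (skewP g fun z => h (a z)) =
      ∑ x, ∑ a : X → I, (∏ z, u (a z)) *
      ∑ i, 1 / (perP (skewP g fun z => h (a z)) (x, i) : ℝ) := by
    rw [Finset.sum_comm]
    refine Finset.sum_congr rfl fun a _ => ?_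
    rw [phiP, Fintype.sum_prod_type, Finset.mul_sum]
  rw [hsw, phiP, Finset.mul_sum]
  exact Finset.sum_le_sum fun x _ => main x

theorem numPer_base {X B I : Type*} [Fintype X] [DecidableEq X] [Fintype B] [Fintype I] (u : I → ℝ)
    (hu : ∀ c, 0 ≤ u c) (hU : 0 < ∑ c, u c) (g : X → Option X) (h : I → B → Option B) (r : ℝ)
    (hr0 : 0 ≤ r)
    (hr : ∀ i, ∑ c, u c * ind (h c i ≠ none) ≤ r * ∑ c, u c)
    (C : ℝ) (hC : ∀ k : ℕ, 0 < k → r ^ k ≤ C * (1 / (k:ℝ))) :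
    ∑ a : X → I, (∏ z, u (a z)) * numPer (skewP g fun z => h (a z)) ≤
      (Fintype.card B * C) * (∑ a : X → I, ∏ z, u (a z)) * phiP g := by
  have hW : 0 ≤ ∑ a : X → I, ∏ z, u (a z) :=
      Finset.sum_nonneg fun a _ => sum_prod_nonneg u hu a
  have main : ∀ x i, ∑ a : X → I, (∏ z, u (a z)) *
      (ind (0 < perP (skewP g fun z => h (a z)) (x, i))) ≤
      C * (∑ a : X → I, ∏ z, u (a z)) * (1 / (perP g x : ℝ)) := by
    intro x i
    rcases Nat.eq_zero_or_pos (perP g x) with h0 | hpos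
    · have : ∀ (a : X → I) i, perP (skewP g fun z => h (a z)) (x, i) = 0 := by
        intro a i
        by_contra hcon
        have := (perP_skew_dvd g _ x i (Nat.pos_of_ne_zero hcon)).1
        omega
      simp [this, h0, ind]
    · have hs := surv_bound u hu hU g h r hr0 hr (perP g x) x (by
        intro m hm m' hm' he
        exact (Function.iterate_eq_iterate_iff_of_lt_minimalPeriod hm hm').1 he) i
      calc _ ≤ ∑ a : X → I, (∏ z, u (a z)) *
          (ind ((liftP (skewP g fun z => h (a z)))^[perP g x] (some (x, i)) ≠ none)) := by
            refine Finset.sum_le_sum fun a _ =>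
              mul_le_mul_of_nonneg_left ?_ (sum_prod_nonneg u hu a)
            by_cases hp : 0 < perP (skewP g fun z => h (a z)) (x, i)
            · rw [ind_pos hp, ind_pos]
              intro hn
              obtain ⟨hL, c, hc⟩ := perP_skew_dvd g _ x i hp
              have h1 : (liftP (skewP g fun z => h (a z)))^[perP (skewP g fun z => h (a z)) (x, i)]
                (some (x, i)) = some (x, i) := Function.iterate_minimalPeriod
              have hle := Nat.le_of_dvd hp ⟨c, hc⟩
              rw [← Nat.sub_add_cancel hle, Function.iterate_add_apply, hn, liftP_iter_none] at h1
              cases h1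
            · rw [ind_neg hp]; exact ind_nonneg _
        _ ≤ _ := hs
        _ ≤ (C * (1 / (perP g x : ℝ))) * ∑ a : X → I, ∏ z, u (a z) := by
            gcongr; exact hC _ hpos
        _ = _ := by ring
  have hsw : ∑ a : X → I, (∏ z, u (a z)) * numPer (skewP g fun z => h (a z)) =
      ∑ x, ∑ i, ∑ a : X → I, (∏ z, u (a z)) *
        ind (0 < perP (skewP g fun z => h (a z)) (x, i)) := by
    rw [← Fintype.sum_prod_type', Finset.sum_comm]
    refine Finset.sum_congr rfl fun a _ => ?_
    rw [numPer, Finset.mul_sum]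
  rw [hsw, phiP, Finset.mul_sum]
  refine Finset.sum_le_sum fun x _ => ?_
  refine le_trans (Finset.sum_le_sum fun i _ => main x i) ?_
  simp only [Finset.sum_const, Finset.card_univ, nsmul_eq_mul]
  apply le_of_eq
  ring

theorem decomp_gen {X A B : Type*} [Fintype X] [DecidableEq X] [Fintype A] [Fintype B]
    (θ : A → B) (v : A → ℝ) (hv : ∀ b, ∑ p, v p * ind (θ p = b) = 1) (F : (X → B) → ℝ) :
    ∑ y : X → B, F y = ∑ z : X → A, (∏ x, v (z x)) * F (fun x => θ (z x)) := by
  classical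
  have h1 : ∀ z : X → A, F (fun x => θ (z x)) = ∑ y : X → B, F y * ∏ x, ind (θ (z x) = y x) := by
    intro z
    rw [Finset.sum_eq_single (fun x => θ (z x))]
    · simp [ind]
    · intro y _ hy
      have : ∃ x, θ (z x) ≠ y x := by
        by_contra hcon
        push Not at hcon
        exact hy (funext fun x => (hcon x).symm)
      obtain ⟨x, hx⟩ := this
      rw [Finset.prod_eq_zero (Finset.mem_univ x) (ind_neg hx), mul_zero]
    · simp
  have h2 : ∀ y : X → B, ∑ z : X → A, ∏ x, (v (z x) * ind (θ (z x) = y x)) = 1 := by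
    intro y
    have := Finset.prod_univ_sum (fun _ : X => (Finset.univ : Finset A))
      (fun x p => v p * ind (θ p = y x))
    rw [Fintype.piFinset_univ] at this
    rw [← this]
    exact Finset.prod_eq_one fun x _ => hv _
  simp_rw [h1, Finset.mul_sum]
  rw [Finset.sum_comm]
  refine Finset.sum_congr rfl fun y _ => ?_
  calc F y = F y * ∑ z : X → A, ∏ x, (v (z x) * ind (θ (z x) = y x)) := by rw [h2, mul_one]
    _ = _ := by
      rw [Finset.mul_sum]
      refine Finset.sum_congr rfl fun z _ => ?_
      rw [Finset.prod_mul_distrib]; ring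

/-- Number of points where the partial injection is undefined. -/
def codimP {d : ℕ} (a : PInj (Fin d)) : ℕ := Fintype.card {i : Fin d // ¬ (a.1 i).isSome}

/-- Weight of a label. -/
noncomputable def wt (d n : ℕ) (a : PInj (Fin d)) : ℝ :=
  (((Fintype.card (Pn d n) : ℝ)) ^ codimP a)⁻¹

/-- Restrict a total family to the domain of the label. -/
def thetaP {d n : ℕ} (p : PInj (Fin d) × (Fin d → Pn d n)) : Pn d (n + 1) :=
  ⟨p.1, fun x => p.2 x.1⟩

def emptyP (d : ℕ) : PInj (Fin d) := ⟨fun _ => none, fun _ _ _ h => by cases h⟩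

theorem Pn_nonempty (d : ℕ) : ∀ n, Nonempty (Pn d n)
  | 0 => ⟨PUnit.unit⟩
  | n + 1 => by
    obtain ⟨y⟩ := Pn_nonempty d n
    exact ⟨thetaP (emptyP d, fun _ => y)⟩

theorem Pn_card_pos (d n : ℕ) : (0:ℝ) < Fintype.card (Pn d n) := by
  have := Pn_nonempty d n
  exact_mod_cast Fintype.card_pos

theorem wt_pos (d n : ℕ) (a : PInj (Fin d)) : 0 < wt d n a :=
  inv_pos.2 (pow_pos (Pn_card_pos d n) _)

theorem wt_sum_pos (d n : ℕ) : 0 < ∑ a, wt d n a :=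
  Finset.sum_pos (fun a _ => wt_pos d n a) ⟨emptyP d, Finset.mem_univ _⟩

theorem fiber_count {D P : Type*} [Fintype D] [DecidableEq D] [Fintype P] (q : D → Prop)
    [DecidablePred q] (f : {x // q x} → P) :
    ∑ f' : D → P, ind ((fun x : {x // q x} => f' x.1) = f) =
      (Fintype.card P : ℝ) ^ Fintype.card {x // ¬ q x} := by
  classical
  rw [← Equiv.sum_comp (Equiv.piEquivPiSubtypeProd q (fun _ => P)).symm, Fintype.sum_prod_type]
  rw [Finset.sum_eq_single f]
  · rw [Finset.sum_congr rfl (g := fun _ => (1:ℝ))]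
    · simp
    · intro f2 _
      apply ind_pos
      funext x
      simp [Equiv.piEquivPiSubtypeProd, x.2]
  · intro f1 _ hf1
    refine Finset.sum_eq_zero fun f2 _ => ind_neg ?_
    intro h
    apply hf1
    rw [← h]
    funext x
    simp [Equiv.piEquivPiSubtypeProd, x.2]
  · simp

theorem fiber_theta (d n : ℕ) (b : Pn d (n+1)) :
    ∑ p : PInj (Fin d) × (Fin d → Pn d n), wt d n p.1 * ind (thetaP p = b) = 1 := by
  classical
  obtain ⟨a, f⟩ := b
  rw [Fintype.sum_prod_type, Finset.sum_eq_single a]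
  · have h1 : ∀ f' : Fin d → Pn d n,
        wt d n a * ind (thetaP (a, f') = (⟨a, f⟩ : Pn d (n+1))) =
        wt d n a * ind ((fun x : {x // (a.1 x).isSome} => f' x.1) = f) := by
      intro f'
      congr 2
      apply propext
      constructor
      · intro h
        have := eq_of_heq (Sigma.mk.inj h).2
        exact this
      · intro h
        rw [← h]; rfl
    refine Eq.trans (Finset.sum_congr rfl fun f' _ => h1 f') ?_
    rw [← Finset.mul_sum]
    have := fiber_count (fun x => ((a.1 x).isSome : Prop)) f
    refine Eq.trans (congrArg _ this) ?_
    unfold wt codimP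
    exact inv_mul_cancel₀ (pow_pos (Pn_card_pos d n) _).ne'
  · intro a' _ ha'
    refine Finset.sum_eq_zero fun f' _ => ?_
    rw [ind_neg, mul_zero]
    intro h
    exact ha' (Sigma.mk.inj h).1
  · simp

theorem decomp (d n : ℕ) {X : Type*} [Fintype X] [DecidableEq X] (F : (X → Pn d (n+1)) → ℝ) :
    ∑ y : X → Pn d (n+1), F y = ∑ a : X → PInj (Fin d), (∏ x, wt d n (a x)) *
      ∑ f : X × Fin d → Pn d n, F (fun x => thetaP (a x, fun i => f (x, i))) := by
  rw [decomp_gen thetaP (fun p => wt d n p.1) (fiber_theta d n) F]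
  rw [← Equiv.sum_comp (Equiv.arrowProdEquivProdArrow X (fun _ => PInj (Fin d))
    (fun _ => Fin d → Pn d n)).symm, Fintype.sum_prod_type]
  refine Finset.sum_congr rfl fun a _ => ?_
  rw [← Equiv.sum_comp (Equiv.curry X (Fin d) (Pn d n)), Finset.mul_sum]
  rfl

theorem decomp_card (d n : ℕ) {X : Type*} [Fintype X] [DecidableEq X] :
    (∑ a : X → PInj (Fin d), (∏ x, wt d n (a x))) *
      (Fintype.card (Pn d n) : ℝ) ^ Fintype.card (X × Fin d) =
      (Fintype.card (Pn d (n+1)) : ℝ) ^ Fintype.card X := by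
  have := decomp d n (X := X) (fun _ => 1)
  simp only [Finset.sum_const, Finset.card_univ, nsmul_eq_mul, mul_one, Fintype.card_fun] at this
  rw [← Finset.sum_mul] at this
  push_cast at this
  rw [this]

/-- Splitting the first letter off a path. -/
def splitE (X : Type*) (d n : ℕ) :
    X × (Fin (n+1) → Fin d) ≃ (X × Fin d) × (Fin n → Fin d) where
  toFun p := ((p.1, p.2 0), Fin.tail p.2)
  invFun q := (q.1.1, Fin.cons q.1.2 q.2)
  left_inv p := by simp
  right_inv q := by simp

theorem act_theta (d n : ℕ) (a : PInj (Fin d)) (f : Fin d → Pn d n) (v : Fin (n+1) → Fin d) :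
    Pn.act (thetaP (a, f)) v = if h : (a.1 (v 0)).isSome then
      (Pn.act (f (v 0)) (Fin.tail v)).map (fun w => Fin.cons ((a.1 (v 0)).get h) w)
      else none := by
  rw [Pn.act]
  rfl

theorem numPer_theta (d n : ℕ) {X : Type*} [Fintype X] (g : X → Option X)
    (a : X → PInj (Fin d)) (f : X × Fin d → Pn d n) :
    numPer (skewP g fun x => Pn.act (thetaP (a x, fun i => f (x, i)))) =
      numPer (skewP (skewP g fun x => (a x).1) fun q => Pn.act (f q)) := by
  symm
  apply numPer_conj (splitE X d n)
  rintro ⟨x, v⟩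
  simp only [skewP, splitE, Equiv.coe_fn_mk]
  rcases g x with _ | x1
  · rfl
  · simp only [Option.bind_some]
    by_cases hs : ((a x).1 (v 0)).isSome
    · obtain ⟨j, hj⟩ := Option.isSome_iff_exists.1 hs
      have : Pn.act (thetaP (a x, fun i => f (x, i))) v =
          (Pn.act (f (x, v 0)) (Fin.tail v)).map (fun w => Fin.cons j w) := by
        rw [act_theta, dif_pos hs]
        simp [hj]
      rw [this, hj]
      rcases Pn.act (f (x, v 0)) (Fin.tail v) with _ | w
      · rfl
      · simp
    · have : Pn.act (thetaP (a x, fun i => f (x, i))) v = none := by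
        rw [act_theta, dif_neg hs]
      rw [this]
      have h2 : (a x).1 (v 0) = none := by simpa using hs
      rw [h2]
      rfl

theorem numPer_zero (d : ℕ) {X : Type*} [Fintype X] (g : X → Option X) (f : X → Pn d 0) :
    numPer (skewP g fun q => Pn.act (f q)) = numPer g := by
  symm
  apply numPer_conj (Equiv.prodUnique X (Fin 0 → Fin d))
  rintro ⟨x, v⟩
  simp only [skewP, Pn.act, Equiv.prodUnique_apply]
  rcases g x with _ | x1 <;> rfl

theorem wt_sym (d n : ℕ) (i j : Fin d) :
    (Fintype.card (Fin d) : ℝ) * ∑ c : PInj (Fin d), wt d n c * ind (c.1 i = some j)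
      ≤ ∑ c : PInj (Fin d), wt d n c := by
  have hsw : ∀ i', ∑ c : PInj (Fin d), wt d n c * ind (c.1 i = some j) =
      ∑ c : PInj (Fin d), wt d n c * ind (c.1 i' = some j) := by
    intro i'
    let τ : PInj (Fin d) → PInj (Fin d) := fun c => ⟨fun x => c.1 (Equiv.swap i i' x), by
      intro x y z hx hy
      exact (Equiv.swap i i').injective (c.2 hx hy)⟩
    have hτ : Function.Involutive τ := by
      intro c
      apply Subtype.ext
      funext x
      simp [τ]
    rw [← Equiv.sum_comp hτ.toPerm]
    refine Finset.sum_congr rfl fun c _ => ?_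
    have h1 : codimP (τ c) = codimP c := by
      unfold codimP
      exact Fintype.card_congr ((Equiv.swap i i').subtypeEquiv (by intro x; rfl))
    simp only [Function.Involutive.coe_toPerm]
    have h2 : (τ c).1 i = c.1 i' := by simp [τ]
    rw [wt, h1, h2, wt]
  calc (Fintype.card (Fin d) : ℝ) * ∑ c : PInj (Fin d), wt d n c * ind (c.1 i = some j)
      = ∑ i', ∑ c : PInj (Fin d), wt d n c * ind (c.1 i' = some j) := by
        rw [← Finset.sum_congr rfl fun i' _ => hsw i']
        simp
    _ = ∑ c : PInj (Fin d), wt d n c * ∑ i', ind (c.1 i' = some j) := by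
        rw [Finset.sum_comm]
        simp_rw [Finset.mul_sum]
    _ ≤ ∑ c : PInj (Fin d), wt d n c * 1 := by
        refine Finset.sum_le_sum fun c _ => mul_le_mul_of_nonneg_left ?_ (wt_pos d n c).le
        by_cases hex : ∃ i0, c.1 i0 = some j
        · obtain ⟨i0, h0⟩ := hex
          rw [Finset.sum_eq_single i0]
          · exact ind_le_one _
          · intro b _ hb
            apply ind_neg
            intro h
            exact hb (c.2 h h0)
          · simp
        · push Not at hex
          rw [Finset.sum_eq_zero fun b _ => ind_neg (hex b)]
          norm_num
    _ = _ := by simp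

theorem geom_bound (M : ℝ) (hM : 1 ≤ M) (k : ℕ) (hk : 0 < k) :
    (1 - 1 / M) ^ k ≤ M * (1 / (k:ℝ)) := by
  have hM0 : 0 < M := by linarith
  have hr : 0 ≤ 1 - 1 / M := by
    rw [sub_nonneg, div_le_one hM0]; exact hM
  have hk' : (0:ℝ) < k := by exact_mod_cast hk
  have h1 : 1 + (k:ℝ) * (1 / M) ≤ (1 + 1 / M) ^ k :=
    one_add_mul_le_pow (by have : 0 < 1 / M := by positivity
                           linarith) k
  have h2 : (1 - 1 / M) ^ k * (1 + 1 / M) ^ k ≤ 1 := by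
    rw [← mul_pow]
    apply pow_le_one₀
    · positivity
    · nlinarith [sq_nonneg (1 / M)]
  have h3 : (1 - 1 / M) ^ k * (1 + (k:ℝ) * (1 / M)) ≤ 1 :=
    le_trans (mul_le_mul_of_nonneg_left h1 (pow_nonneg hr k)) h2
  have h4 : (1 - 1 / M) ^ k * ((k:ℝ) * (1 / M)) ≤ 1 := by
    nlinarith [pow_nonneg hr k]
  rw [mul_one_div, le_div_iff₀ hk']
  calc (1 - 1 / M) ^ k * k = ((1 - 1 / M) ^ k * ((k:ℝ) * (1 / M))) * M := by field_simp
    _ ≤ 1 * M := by gcongr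
    _ = M := one_mul _

theorem main_bound (d : ℕ) (hd : 0 < d) (n : ℕ) :
    ∀ (X : Type) [Fintype X] [DecidableEq X] (g : X → Option X),
    ∑ y : X → Pn d (n+1), numPer (skewP g fun x => Pn.act (y x)) ≤
      (d * Fintype.card (PInj (Fin d))) * (((d:ℝ) + 1) / 2) ^ n *
        (Fintype.card (Pn d (n+1)) : ℝ) ^ Fintype.card X * phiP g := by
  induction n with
  | zero =>
    intro X _ _ g
    rw [decomp, ← decomp_card d 0]
    have hM : (1:ℝ) ≤ Fintype.card (PInj (Fin d)) := by
      have : 0 < Fintype.card (PInj (Fin d)) := Fintype.card_pos_iff.2 ⟨emptyP d⟩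
      exact_mod_cast this
    have hw : ∀ c, wt d 0 c = 1 := by
      intro c
      have : Fintype.card (Pn d 0) = 1 := Fintype.card_punit
      simp [wt, this]
    have hb := numPer_base (wt d 0) (fun c => (wt_pos d 0 c).le) (wt_sum_pos d 0) g
      (fun c : PInj (Fin d) => c.1) (1 - 1 / Fintype.card (PInj (Fin d)))
      (by rw [sub_nonneg, div_le_one (by linarith)]; exact hM)
      (by
        intro i
        simp only [hw, one_mul, Finset.sum_const, Finset.card_univ, nsmul_eq_mul, mul_one]
        rw [sub_mul, one_div, inv_mul_cancel₀ (by linarith), one_mul,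
          ← Finset.add_sum_erase _ _ (Finset.mem_univ (emptyP d)),
          ind_neg (by simp [emptyP]), zero_add]
        refine le_trans (Finset.sum_le_sum fun c _ => ind_le_one _) ?_
        rw [Finset.sum_const, Finset.card_erase_of_mem (Finset.mem_univ _), Finset.card_univ,
          nsmul_eq_mul, mul_one, Nat.cast_sub (by exact_mod_cast hM)]
        simp)
      (Fintype.card (PInj (Fin d))) (fun k hk => geom_bound _ hM k hk)
    have hN : (Fintype.card (Pn d 0)) = 1 := Fintype.card_punit
    rw [Fintype.card_fin] at hb
    calc _ = ∑ a : X → PInj (Fin d), (∏ z, wt d 0 (a z)) * numPer (skewP g fun z => (a z).1) := by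
          refine Finset.sum_congr rfl fun a _ => ?_
          congr 1
          rw [Finset.sum_congr rfl fun f _ => (numPer_theta d 0 g a f).trans
            (numPer_zero d _ f)]
          simp [hN]
      _ ≤ _ := hb
      _ = _ := by rw [hN]; simp
  | succ n ih =>
    intro X _ _ g
    rw [decomp, ← decomp_card d (n+1)]
    have hb := phi_step (wt d (n+1)) (fun c => (wt_pos d (n+1) c).le) (wt_sum_pos d (n+1)) g
      (fun c : PInj (Fin d) => c.1) (wt_sym d (n+1)) (by simpa using hd)
    rw [Fintype.card_fin] at hb
    set K : ℝ := (d * Fintype.card (PInj (Fin d))) * (((d:ℝ) + 1) / 2) ^ n *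
      (Fintype.card (Pn d (n+1)) : ℝ) ^ Fintype.card (X × Fin d) with hK
    have hK0 : 0 ≤ K := by positivity
    calc _ ≤ ∑ a : X → PInj (Fin d), (∏ z, wt d (n+1) (a z)) *
            (K * phiP (skewP g fun z => (a z).1)) := by
          refine Finset.sum_le_sum fun a _ => mul_le_mul_of_nonneg_left ?_
            (sum_prod_nonneg _ (fun c => (wt_pos d (n+1) c).le) a)
          rw [Finset.sum_congr rfl fun f _ => numPer_theta d (n+1) g a f]
          exact ih (X × Fin d) _
      _ = K * ∑ a : X → PInj (Fin d), (∏ z, wt d (n+1) (a z)) *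
            phiP (skewP g fun z => (a z).1) := by
          rw [Finset.mul_sum]
          refine Finset.sum_congr rfl fun a _ => ?_
          ring
      _ ≤ K * _ := mul_le_mul_of_nonneg_left hb hK0
      _ = _ := by rw [hK]; ring

theorem main_single (d : ℕ) (hd : 0 < d) (n : ℕ) :
    ∑ y : Pn d (n+1), numPer (Pn.act y) ≤
      (d * Fintype.card (PInj (Fin d))) * (((d:ℝ) + 1) / 2) ^ n *
        (Fintype.card (Pn d (n+1)) : ℝ) := by
  have h := main_bound d hd n Unit some
  have hphi : phiP (some : Unit → Option Unit) = 1 := by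
    have : perP (some : Unit → Option Unit) () = 1 := by
      unfold perP
      rw [Function.minimalPeriod_eq_one_iff_isFixedPt]
      rfl
    simp [phiP, this]
  rw [hphi, mul_one, Fintype.card_unit, pow_one] at h
  refine le_trans (le_of_eq ?_) h
  rw [← Equiv.sum_comp (Equiv.funUnique Unit (Pn d (n+1)))]
  refine Finset.sum_congr rfl fun y _ => ?_
  symm
  apply numPer_conj (Equiv.uniqueProd (Fin (n+1) → Fin d) Unit).symm
  intro v
  simp [skewP]
  rfl

theorem main_frac (d : ℕ) (hd : 0 < d) (n : ℕ) :
    ∑ y : Pn d (n+1), ((d ^ (n+1) - numZeroEig y : ℕ) : ℝ) / ((d : ℝ) ^ (n+1)) ≤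
      (Fintype.card (PInj (Fin d)) : ℝ) * (((d:ℝ) + 1) / (2 * d)) ^ n *
        (Fintype.card (Pn d (n+1)) : ℝ) := by
  have hd' : (0:ℝ) < d := by exact_mod_cast hd
  rw [← Finset.sum_div, div_le_iff₀ (by positivity)]
  refine le_trans (Finset.sum_le_sum fun y _ => ?_) (le_trans (main_single d hd n) (le_of_eq ?_))
  · have := charpoly_bound (Pn.act y) (actMatrix y) (fun v w => rfl)
    simpa [numZeroEig] using this
  · rw [div_pow, div_pow, mul_pow]
    field_simp
    ring

theorem markov {P : Type*} [Fintype P] (f : P → ℝ) (hf : ∀ y, 0 ≤ f y) (ε : ℝ) (hε : 0 < ε)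
    (S : ℝ) (hS : ∑ y, f y ≤ S * Fintype.card P) (hP : (0:ℝ) < Fintype.card P) :
    (Nat.card {y // ε ≤ f y} : ℝ) / Fintype.card P ≤ S / ε := by
  classical
  rw [Nat.card_eq_fintype_card, Fintype.card_subtype, div_le_div_iff₀ hP hε]
  refine le_trans ?_ hS
  rw [← nsmul_eq_mul, ← Finset.sum_const]
  refine le_trans (Finset.sum_le_sum fun y hy => (Finset.mem_filter.1 hy).2) ?_
  exact Finset.sum_le_sum_of_subset_of_nonneg (Finset.filter_subset _ _) fun y _ _ => hf y

theorem numZeroEig_le {d n : ℕ} (y : Pn d n) : numZeroEig y ≤ d ^ n := by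
  unfold numZeroEig
  have h1 := Polynomial.rootMultiplicity_le_rootMultiplicity_of_dvd
    (Matrix.charpoly_monic (actMatrix y)).ne_zero dvd_rfl 0
  have h2 : ((actMatrix y).charpoly).rootMultiplicity 0 ≤ (actMatrix y).charpoly.natDegree := by
    rw [← Polynomial.count_roots]
    exact le_trans (Multiset.count_le_card _ _) (Polynomial.card_roots' _)
  rw [Matrix.charpoly_natDegree_eq_dim] at h2
  simpa using h2

theorem first_part (d : ℕ) (hd : 2 ≤ d) (ε : ℝ) (hε : 0 < ε) :
      Filter.Tendsto
        (fun n : ℕ =>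
          (Nat.card {y : Pn d n //
              ε ≤ ((d ^ n - numZeroEig y : ℕ) : ℝ) / ((d : ℝ) ^ n)} : ℝ)
            / (Fintype.card (Pn d n) : ℝ))
        Filter.atTop (nhds 0) := by
  rw [← Filter.tendsto_add_atTop_iff_nat 1]
  have hd' : (2:ℝ) ≤ d := by exact_mod_cast hd
  have ht : Filter.Tendsto (fun n : ℕ => ((Fintype.card (PInj (Fin d)) : ℝ) *
      (((d:ℝ) + 1) / (2 * d)) ^ n) / ε) Filter.atTop (nhds 0) := by
    have h1 := tendsto_pow_atTop_nhds_zero_of_lt_one (r := ((d:ℝ) + 1) / (2 * d))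
      (by positivity) (by rw [div_lt_one (by positivity)]; linarith)
    have h2 := (h1.const_mul (Fintype.card (PInj (Fin d)) : ℝ)).div_const ε
    simpa using h2
  refine squeeze_zero (fun n => by positivity) (fun n => ?_) ht
  exact markov _ (fun y => by positivity) ε hε _ (main_frac d (by omega) n) (Pn_card_pos d (n+1))

/-- For `d ≥ 2` and `y` uniform on `P_n`, the fraction
`ξ_n(y) = (d^n - (multiplicity of 0))/d^n` of non-zero eigenvalues of `A_y` tends
to `0` in probability, and equivalently the fraction `η_n(y)` of zero eigenvalues
tends to `1` in probability, as `n → ∞`. -/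
theorem fraction_nonzero_eigenvalues_tendsto_zero_in_probability
    (d : ℕ) (hd : 2 ≤ d) :
    (∀ ε : ℝ, 0 < ε →
      Filter.Tendsto
        (fun n : ℕ =>
          (Nat.card {y : Pn d n //
              ε ≤ ((d ^ n - numZeroEig y : ℕ) : ℝ) / ((d : ℝ) ^ n)} : ℝ)
            / (Fintype.card (Pn d n) : ℝ))
        Filter.atTop (nhds 0))
    ∧
    (∀ ε : ℝ, 0 < ε →
      Filter.Tendsto
        (fun n : ℕ =>
          (Nat.card {y : Pn d n //
              ε ≤ |(numZeroEig y : ℝ) / ((d : ℝ) ^ n) - 1|} : ℝ)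
            / (Fintype.card (Pn d n) : ℝ))
        Filter.atTop (nhds 0)) := by
  refine ⟨first_part d hd, fun ε hε => ?_⟩
  refine (first_part d hd ε hε).congr fun n => ?_
  have hd' : (0:ℝ) < (d:ℝ) ^ n := by
    have : (0:ℝ) < d := by exact_mod_cast (by omega : 0 < d)
    positivity
  have key : ∀ y : Pn d n, ((d ^ n - numZeroEig y : ℕ) : ℝ) / ((d : ℝ) ^ n) =
      |(numZeroEig y : ℝ) / ((d : ℝ) ^ n) - 1| := by
    intro y
    have hle := numZeroEig_le y
    have hle' : (numZeroEig y : ℝ) ≤ (d:ℝ) ^ n := by exact_mod_cast hle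
    rw [Nat.cast_sub hle, Nat.cast_pow, abs_of_nonpos, sub_div, div_self hd'.ne', neg_sub]
    rw [sub_nonpos, div_le_one hd']
    exact hle'
  simp_rw [key]
end
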